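/- arXiv:2405.05325 — 12 statements merged into one kernel-verified Lean document; each statement's English description precedes it below -/
import Mathlib

section
/- Let V be a finite-dimensional complex vector space and f : V → V a ℂ-linear endomorphism such that trace(f^L) = 1 for every integer L ≥ 1. Then the characteristic polynomial of f equals X^(d−1)·(X − 1), where d = dim V; equivalently, 1 is an eigenvalue of f of algebraic multiplicity one and all other eigenvalues of f (with multiplicity) are 0. -/
open Polynomial

section

variable {K V : Type*} [Field K] [AddCommGroup V] [Module K V] [FiniteDimensional K V]

/-- If all positive powers of `f` have trace one, then the trace of `p(f)` depends only on the
values of `p` at `0` and `1`. -/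
theorem LinearMap.trace_aeval_of_trace_pow_eq_one (f : V →ₗ[K] V)
    (htr : ∀ L : ℕ, 1 ≤ L → LinearMap.trace K V (f ^ L) = 1) (p : K[X]) :
    LinearMap.trace K V (aeval f p) =
      p.eval 1 + ((Module.finrank K V : K) - 1) * p.eval 0 := by
  induction p using Polynomial.induction_on' with
  | add p q hp hq => simp only [map_add, hp, hq, eval_add]; ring
  | monomial n a =>
    rw [← smul_X_eq_monomial, map_smul, map_smul, map_pow, aeval_X]
    rcases Nat.eq_zero_or_pos n with rfl | hn
    · simp only [pow_zero, LinearMap.trace_one, smul_eq_mul, eval_smul, eval_one]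
      ring
    · simp [htr n hn, hn.ne']

variable [IsAlgClosed K]

/-- The determinant of `p(f)` is the product of the values of `p` at the eigenvalues of `f`. -/
theorem LinearMap.det_aeval_eq_prod_roots_charpoly (f : V →ₗ[K] V) (p : K[X]) :
    LinearMap.det (aeval f p) = (f.charpoly.roots.map fun ξ => p.eval ξ).prod := by
  have hcard : Multiset.card f.charpoly.roots = Module.finrank K V := by
    rw [← (IsAlgClosed.splits f.charpoly).natDegree_eq_card_roots, f.charpoly_natDegree]
  have hlin (a : K) : LinearMap.det (aeval f (X - C a)) =
      (f.charpoly.roots.map fun ξ => (X - C a).eval ξ).prod := by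
    have heval : LinearMap.det (algebraMap K (Module.End K V) a - f) =
        (f.charpoly.roots.map fun ξ => a - ξ).prod := by
      rw [← LinearMap.eval_charpoly,
        (IsAlgClosed.splits f.charpoly).eval_eq_prod_roots_of_monic f.charpoly_monic]
    have hneg : aeval f (X - C a) = (-1 : K) • (algebraMap K (Module.End K V) a - f) := by
      simp
    rw [hneg, LinearMap.det_smul, heval, ← hcard, ← Multiset.card_map (fun ξ => a - ξ),
      ← Multiset.prod_map_neg, Multiset.map_map]
    simp
  rw [(IsAlgClosed.splits p).eq_prod_roots]
  generalize p.leadingCoeff = c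
  induction p.roots using Multiset.induction_on with
  | empty => simp [hcard, Algebra.algebraMap_eq_smul_one]
  | cons a s ih =>
    rw [Multiset.map_cons, Multiset.prod_cons, mul_left_comm, map_mul, map_mul, ih, hlin,
      ← Multiset.prod_map_mul]
    simp only [eval_mul]

/-- The eigenvalues of `p(f)`, with multiplicity, are the values of `p` at those of `f`. -/
theorem LinearMap.roots_charpoly_aeval (f : V →ₗ[K] V) (p : K[X]) :
    (LinearMap.charpoly (aeval f p)).roots = f.charpoly.roots.map fun ξ => p.eval ξ := by
  have h : LinearMap.charpoly (aeval f p) =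
      ((f.charpoly.roots.map fun ξ => p.eval ξ).map fun y => X - C y).prod := by
    refine Polynomial.funext fun y => ?_
    have h1 := f.det_aeval_eq_prod_roots_charpoly (C y - p)
    rw [map_sub, aeval_C] at h1
    rw [LinearMap.eval_charpoly, h1, eval_multiset_prod, Multiset.map_map, Multiset.map_map]
    simp
  rw [h, roots_multiset_prod_X_sub_C]

theorem LinearMap.trace_aeval_eq_sum_roots_charpoly (f : V →ₗ[K] V) (p : K[X]) :
    LinearMap.trace K V (aeval f p) = (f.charpoly.roots.map fun ξ => p.eval ξ).sum := by
  rw [Module.End.trace_eq_sum_roots_charpoly_of_splits (IsAlgClosed.splits _),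
    f.roots_charpoly_aeval]

theorem LinearMap.count_roots_charpoly_of_trace_pow_eq_one [DecidableEq K] (f : V →ₗ[K] V)
    (htr : ∀ L : ℕ, 1 ≤ L → LinearMap.trace K V (f ^ L) = 1) (μ : K) :
    (f.charpoly.roots.count μ : K) =
      (if 1 = μ then 1 else 0) + ((Module.finrank K V : K) - 1) * (if 0 = μ then 1 else 0) := by
  let S : Finset K := insert μ (insert 0 (insert 1 f.charpoly.roots.toFinset))
  let p := Lagrange.basis S _root_.id μ
  have hp : ∀ ξ ∈ S, p.eval ξ = if ξ = μ then 1 else 0 := by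
    intro ξ hξ
    split_ifs with h
    · subst h
      exact Lagrange.eval_basis_self Function.injective_id.injOn hξ
    · exact Lagrange.eval_basis_of_ne (v := _root_.id) (Ne.symm h) hξ
  have h := f.trace_aeval_of_trace_pow_eq_one htr p
  rw [f.trace_aeval_eq_sum_roots_charpoly, hp 1 (by simp [S]), hp 0 (by simp [S]),
    Multiset.map_congr rfl fun ξ hξ => hp ξ
      (by simp only [S, Finset.mem_insert, Multiset.mem_toFinset, hξ, or_true])] at h
  rw [← h, Multiset.sum_map_eq_nsmul_single μ fun ξ hξ _ => if_neg hξ]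
  simp

end

/-- If a linear endomorphism `f` of a finite-dimensional complex vector space satisfies
`trace (f^L) = 1` for every `L ≥ 1`, then its characteristic polynomial is
`X^(d-1) * (X - 1)` where `d = dim V`. -/
theorem stmt_0 (V : Type*) [AddCommGroup V] [Module ℂ V] [FiniteDimensional ℂ V]
    (f : V →ₗ[ℂ] V)
    (htr : ∀ L : ℕ, 1 ≤ L → LinearMap.trace ℂ V (f ^ L) = 1) :
    LinearMap.charpoly f = X ^ (Module.finrank ℂ V - 1) * (X - 1) := by
  have hd : 1 ≤ Module.finrank ℂ V := by
    by_contra! h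
    have : Subsingleton V := Module.finrank_zero_iff (R := ℂ) |>.mp (by lia)
    have h1 := htr 1 le_rfl
    rw [Subsingleton.elim (f ^ 1) 0, map_zero] at h1
    exact zero_ne_one h1
  have hroots : f.charpoly.roots = Multiset.replicate (Module.finrank ℂ V - 1) 0 + {1} := by
    ext μ
    rw [← Nat.cast_inj (R := ℂ), f.count_roots_charpoly_of_trace_pow_eq_one htr,
      Multiset.count_add, Multiset.count_replicate, Multiset.count_singleton]
    push_cast [Nat.cast_sub hd]
    rw [mul_ite, mul_one, mul_zero, add_comm]
    simp only [eq_comm]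
  rw [(IsAlgClosed.splits f.charpoly).eq_prod_roots_of_monic f.charpoly_monic, hroots]
  simp
end

section
/- Let D, χ₁, χ₂ be positive integers, let B₁ : Fin D → Fin D → Matrix (Fin χ₁) (Fin χ₁) ℂ and B₂ : Fin D → Fin D → Matrix (Fin χ₂) (Fin χ₂) ℂ be families of matrices, and let c ∈ ℂ with c ≠ 0. For i, j ∈ Fin D set C^(ij) := ∑_{k ∈ Fin D} B₁^(ik) ⊗ₖ B₂^(kj), a (χ₁·χ₂)×(χ₁·χ₂) matrix (⊗ₖ is the Kronecker product). Assume that for every L ≥ 1 and all tuples i, j : Fin L → Fin D one has trace(C^(i₁j₁)·C^(i₂j₂)⋯C^(i_L j_L)) = c^L · ∏_l (if i_l = j_l then 1 else 0). Then the 2-transfer matrix T := (c·D)⁻¹ • ∑_{i,j ∈ Fin D} B₁^(ij) ⊗ₖ B₂^(ji) has characteristic polynomial X^(χ₁χ₂ − 1)·(X − 1); in particular its eigenvalues are contained in {0, 1} and the eigenvalue 1 has algebraic multiplicity one. -/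
open Polynomial Matrix Kronecker

theorem sum_pow_eq_sum_prod_ofFn {R ι : Type*} [Semiring R] [Fintype ι] (f : ι → R) (L : ℕ) :
    (∑ i, f i) ^ L = ∑ g : Fin L → ι, (List.ofFn fun l => f (g l)).prod := by
  induction L with
  | zero => simp
  | succ L ih =>
    rw [pow_succ', ih, Finset.sum_mul_sum, ← Fintype.sum_prod_type',
      ← (Fin.consEquiv fun _ : Fin (L + 1) => ι).sum_comp]
    exact Finset.sum_congr rfl fun x _ => by simp [List.ofFn_succ, Fin.consEquiv]

namespace Matrix

variable {n K : Type*} [Fintype n] [DecidableEq n] [Field K] [IsAlgClosed K]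

theorem det_aeval_eq_prod_roots_charpoly (A : Matrix n n K) (p : K[X]) :
    (aeval A p).det = (A.charpoly.roots.map fun r => p.eval r).prod := by
  have hcard : Multiset.card A.charpoly.roots = Fintype.card n := by
    rw [← (IsAlgClosed.splits A.charpoly).natDegree_eq_card_roots, charpoly_natDegree_eq_dim]
  have hlin (b : K) : (aeval A (X - C b)).det =
      (A.charpoly.roots.map fun r => (X - C b).eval r).prod := by
    have hdet : (aeval A (X - C b)).det = (-1) ^ Fintype.card n * A.charpoly.eval b := by
      rw [eval_charpoly, ← det_neg]
      simp [algebraMap_eq_diagonal, Pi.algebraMap_def]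
    have heval : A.charpoly.eval b = (A.charpoly.roots.map fun r => b - r).prod := by
      conv_lhs => rw [(IsAlgClosed.splits A.charpoly).eq_prod_roots_of_monic A.charpoly_monic]
      simp [eval_multiset_prod]
    rw [hdet, heval, ← hcard, ← Multiset.card_map (fun r => b - r), ← Multiset.prod_map_neg]
    simp
  rw [(IsAlgClosed.splits p).eq_prod_roots]
  generalize p.roots = s
  induction s using Multiset.induction_on with
  | empty => simp [algebraMap_eq_diagonal, Pi.algebraMap_def, hcard]
  | cons b s ih =>
    rw [Multiset.map_cons, Multiset.prod_cons, mul_left_comm, map_mul, det_mul, ih, hlin,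
      ← Multiset.prod_map_mul]
    simp only [eval_mul]

theorem trace_aeval_eq_sum_roots_charpoly (A : Matrix n n K) (p : K[X]) :
    (aeval A p).trace = (A.charpoly.roots.map fun r => p.eval r).sum := by
  have hchar : (aeval A p).charpoly =
      ((A.charpoly.roots.map fun r => p.eval r).map fun a => X - C a).prod := by
    refine Polynomial.funext fun x => ?_
    have h := det_aeval_eq_prod_roots_charpoly A (C x - p)
    rw [map_sub, aeval_C] at h
    rw [eval_charpoly]
    simpa [eval_multiset_prod, algebraMap_eq_diagonal, Pi.algebraMap_def] using h
  rw [trace_eq_sum_roots_charpoly, hchar, roots_multiset_prod_X_sub_C]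

theorem charpoly_eq_of_trace_pow_eq_one [CharZero K] (A : Matrix n n K)
    (h : ∀ L : ℕ, 1 ≤ L → (A ^ L).trace = 1) :
    A.charpoly = X ^ (Fintype.card n - 1) * (X - 1) := by
  classical
  have htrace (q : K[X]) : (aeval A (X * q)).trace = q.eval 1 := by
    induction q using Polynomial.induction_on' with
    | add p q hp hq => rw [mul_add, map_add, trace_add, hp, hq, eval_add]
    | monomial k a =>
      simp [aeval_monomial, ← Algebra.smul_def, h (k + 1) (by simp)]
  set s := A.charpoly.roots with hs
  have hcount (a : K) (ha : a ≠ 0) : s.count a = if a = 1 then 1 else 0 := by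
    set q : K[X] := ∏ b ∈ (insert 1 s.toFinset).erase a, (X - C b) with hq
    have hqa : q.eval a ≠ 0 := by
      simp only [hq, eval_prod, eval_sub, eval_X, eval_C]
      exact Finset.prod_ne_zero_iff.2 fun b hb => sub_ne_zero.2 (Finset.ne_of_mem_erase hb).symm
    have hqb (b : K) (hb : b ∈ insert 1 s.toFinset) (hba : b ≠ a) : q.eval b = 0 := by
      simp only [hq, eval_prod, eval_sub, eval_X, eval_C]
      exact Finset.prod_eq_zero (Finset.mem_erase.2 ⟨hba, hb⟩) (sub_self b)
    have hsum : (s.count a : K) * (a * q.eval a) = q.eval 1 := by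
      rw [← htrace, trace_aeval_eq_sum_roots_charpoly, Finset.sum_multiset_map_count]
      rw [Finset.sum_eq_single a]
      · simp [hs]
      · intro b hb hba
        simp [hqb b (Finset.mem_insert_of_mem hb) hba]
      · intro hb
        rw [Multiset.count_eq_zero.2 (mt Multiset.mem_toFinset.2 hb), zero_smul]
    split_ifs with ha1
    · subst ha1
      rw [one_mul] at hsum
      exact_mod_cast mul_right_cancel₀ hqa (hsum.trans (one_mul _).symm)
    · rw [hqb 1 (Finset.mem_insert_self _ _) (Ne.symm ha1)] at hsum
      simpa [ha, hqa] using hsum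
  have hone : 1 ∈ s := Multiset.count_pos.1 (by simp [hcount 1 one_ne_zero])
  have hcard : Multiset.card s = Fintype.card n := by
    rw [← (IsAlgClosed.splits A.charpoly).natDegree_eq_card_roots, charpoly_natDegree_eq_dim]
  have herase : s.erase 1 = Multiset.replicate (Fintype.card n - 1) 0 := by
    refine Multiset.eq_replicate.2 ⟨by rw [Multiset.card_erase_of_mem hone, hcard]; rfl, ?_⟩
    intro b hb
    by_contra hb0
    have hpos := Multiset.count_pos.2 hb
    by_cases hb1 : b = 1
    · subst hb1
      simp [hcount 1 one_ne_zero] at hpos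
    · simp [Multiset.count_erase_of_ne hb1, hcount b hb0, hb1] at hpos
  rw [(IsAlgClosed.splits A.charpoly).eq_prod_roots_of_monic A.charpoly_monic, ← hs,
    ← Multiset.cons_erase hone, herase]
  simp [mul_comm]

end Matrix

/-- Proposition 1 of the paper in the case `k = 2`: if the MPO generated by the composition
of two MPO tensors `B₁, B₂` equals `c^L` times the identity MPO for every length `L ≥ 1`,
then the 2-transfer matrix `(c·D)⁻¹ • ∑_{i,j} B₁^(ij) ⊗ₖ B₂^(ji)` has characteristic
polynomial `X^(χ₁χ₂ - 1)·(X - 1)`. -/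
theorem stmt_1 (D χ₁ χ₂ : ℕ) (hD : 0 < D) (hχ₁ : 0 < χ₁) (hχ₂ : 0 < χ₂)
    (B₁ : Fin D → Fin D → Matrix (Fin χ₁) (Fin χ₁) ℂ)
    (B₂ : Fin D → Fin D → Matrix (Fin χ₂) (Fin χ₂) ℂ)
    (c : ℂ) (hc : c ≠ 0)
    (h : ∀ L : ℕ, 1 ≤ L → ∀ i j : Fin L → Fin D,
      ((List.ofFn fun l : Fin L =>
          ∑ k : Fin D, B₁ (i l) k ⊗ₖ B₂ k (j l)).prod).trace
        = c ^ L * ∏ l : Fin L, (if i l = j l then (1 : ℂ) else 0)) :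
    ((c * (D : ℂ))⁻¹ • ∑ i : Fin D, ∑ j : Fin D, B₁ i j ⊗ₖ B₂ j i).charpoly
      = X ^ (χ₁ * χ₂ - 1) * (X - 1) := by
  have hD' : (D : ℂ) ≠ 0 := Nat.cast_ne_zero.2 hD.ne'
  rw [charpoly_eq_of_trace_pow_eq_one]
  · simp
  intro L hL
  rw [_root_.smul_pow, sum_pow_eq_sum_prod_ofFn, trace_smul, trace_sum,
    Finset.sum_congr rfl fun g _ => h L hL g g]
  simp [inv_pow, mul_pow]
  field_simp
end

section
/- Let D, a, b be positive integers, X : Fin D → Matrix (Fin a) (Fin a) ℂ and Y : Fin D → Matrix (Fin b) (Fin b) ℂ families of matrices, c ∈ ℂ, and let (V, W) be a reduction from X to Y with constant c, i.e. V ∈ Matrix (Fin b) (Fin a) ℂ, W ∈ Matrix (Fin a) (Fin b) ℂ, V·W = 1, and V·X^(i₁)·X^(i₂)⋯X^(iₘ)·W = c^m • (Y^(i₁)·Y^(i₂)⋯Y^(iₘ)) for every m ≥ 1 and every word i : Fin m → Fin D. Define the nilpotent parts N^(i) := X^(i) − c • (W·Y^(i)·V). Then V·N^(i₁)·N^(i₂)⋯N^(iₘ)·W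 = 0 for every m ≥ 1 and every word i : Fin m → Fin D. -/
open Matrix

/-- If `(V, W)` is a reduction from `X` to `Y`, stated on words given as lists, then a word in `X`
followed by a nonempty word in the nilpotent parts vanishes between `V` and `W`. -/
theorem reduction_mul_nilpotent_word_eq_zero {ι m n R : Type*} [Fintype m] [DecidableEq m]
    [Fintype n] [DecidableEq n] [CommRing R] (X : ι → Matrix m m R) (Y : ι → Matrix n n R) (c : R)
    (V : Matrix n m R) (W : Matrix m n R) (hVW : V * W = 1)
    (hred : ∀ u : List ι, V * (u.map X).prod * W = c ^ u.length • (u.map Y).prod)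
    (w : List ι) (hw : w ≠ []) (u : List ι) :
    V * (u.map X).prod * (w.map fun j => X j - c • (W * Y j * V)).prod * W = 0 := by
  induction w generalizing u with
  | nil => exact absurd rfl hw
  | cons j w ih =>
    set N := (w.map fun j => X j - c • (W * Y j * V)).prod with hN
    have split : V * (u.map X).prod * ((X j - c • (W * Y j * V)) * N) * W
        = V * ((u ++ [j]).map X).prod * N * W
          - c • (V * (u.map X).prod * W * Y j * (V * N * W)) := by
      simp only [List.map_append, List.prod_append, List.map_cons, List.map_nil,
        List.prod_singleton, Matrix.sub_mul, Matrix.mul_sub, Matrix.smul_mul, Matrix.mul_smul,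
        Matrix.mul_assoc]
    rw [List.map_cons, List.prod_cons, ← hN, split]
    rcases eq_or_ne w [] with rfl | hne
    · simp only [List.map_nil, List.prod_nil] at hN
      rw [hN, Matrix.mul_one, Matrix.mul_one, hVW, Matrix.mul_one, hred, hred]
      simp [pow_succ', mul_smul]
    · have h := ih hne []
      rw [List.map_nil, List.prod_nil, Matrix.mul_one] at h
      rw [ih hne, h, Matrix.mul_zero, smul_zero, sub_zero]

/-- Lemma 27 of [MGSC18] (Eq. (lemma27) of the paper): if `(V, W)` is a reduction with
constant `c` from the family `X` to the family `Y`, then sandwiching any word in the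
nilpotent parts `N^(i) = X^(i) - c • (W·Y^(i)·V)` between `V` and `W` gives zero. -/
theorem stmt_5 (D a b : ℕ) (hD : 0 < D) (ha : 0 < a) (hb : 0 < b)
    (X : Fin D → Matrix (Fin a) (Fin a) ℂ)
    (Y : Fin D → Matrix (Fin b) (Fin b) ℂ)
    (c : ℂ)
    (V : Matrix (Fin b) (Fin a) ℂ) (W : Matrix (Fin a) (Fin b) ℂ)
    (hVW : V * W = 1)
    (hred : ∀ m : ℕ, 1 ≤ m → ∀ i : Fin m → Fin D,
      V * (List.ofFn fun l : Fin m => X (i l)).prod * W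
        = c ^ m • (List.ofFn fun l : Fin m => Y (i l)).prod) :
    ∀ m : ℕ, 1 ≤ m → ∀ i : Fin m → Fin D,
      V * (List.ofFn fun l : Fin m => X (i l) - c • (W * Y (i l) * V)).prod * W = 0 := by
  have hlist : ∀ u : List (Fin D),
      V * (u.map X).prod * W = c ^ u.length • (u.map Y).prod := by
    intro u
    rcases eq_or_ne u [] with rfl | hu
    · simpa using hVW
    · have h := hred u.length (List.length_pos_iff.mpr hu) u.get
      have key (n : ℕ) (Z : Fin D → Matrix (Fin n) (Fin n) ℂ) :
          (List.ofFn fun l => Z (u.get l)) = u.map Z := by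
        conv_rhs => rw [← List.ofFn_get u, List.map_ofFn]
        rfl
      rwa [key, key] at h
  intro m hm i
  have hne : List.ofFn i ≠ [] := by
    rw [Ne, List.ofFn_eq_nil_iff]
    omega
  have h := reduction_mul_nilpotent_word_eq_zero X Y c V W hVW hlist (List.ofFn i) hne []
  rw [List.map_nil, List.prod_nil, Matrix.mul_one, List.map_ofFn] at h
  exact h
end

section
/- Let D, a, b be positive integers, X : Fin D → Matrix (Fin a) (Fin a) ℂ, Y : Fin D → Matrix (Fin b) (Fin b) ℂ, c ∈ ℂ, and let (V, W) be a reduction from X to Y with constant c (V·W = 1 and V·X^(i₁)⋯X^(iₘ)·W = c^m • (Y^(i₁)⋯Y^(iₘ)) for all m ≥ 1 and all words). Suppose there is N₀ ∈ ℕ such that every product N^(i₁)·N^(i₂)⋯N^(i_{N₀}) of N₀ of the matrices N^(i) := X^(i) − c • (W·Y^(i)·V) is the zero matrix. Then for every m > N₀ and every word i : Fin (m+1) → Fin D one has the broken zipper identity X^(i₁)⋯X^(iₘ)·X^(i_{m+1})·W = c • (X^(i₁)⋯X^(iₘ)·W·Y^(i_{m+1})). -/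
open Matrix

section BrokenZipper

variable {ι m n R : Type*} [Fintype m] [DecidableEq m] [Fintype n] [DecidableEq n] [CommRing R]

/-- The nilpotent part `X^(i) - c•(W·Y^(i)·V)` of a reduction. -/
def nilpotentPart (X : ι → Matrix m m R) (Y : ι → Matrix n n R) (c : R)
    (V : Matrix n m R) (W : Matrix m n R) (i : ι) : Matrix m m R :=
  X i - c • (W * Y i * V)

variable {X : ι → Matrix m m R} {Y : ι → Matrix n n R} {c : R}
  {V : Matrix n m R} {W : Matrix m n R}

theorem mul_prod_mul_prod_nilpotentPart_mul
    (hred : ∀ w : List ι, V * (w.map X).prod * W = c ^ w.length • (w.map Y).prod)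
    (u : List ι) (hu : u ≠ []) (w : List ι) :
    V * (w.map X).prod * (u.map (nilpotentPart X Y c V W)).prod * W = 0 := by
  induction u generalizing w with
  | nil => exact absurd rfl hu
  | cons j u ih =>
    have hsplit : V * (w.map X).prod * ((j :: u).map (nilpotentPart X Y c V W)).prod * W
        = V * ((w ++ [j]).map X).prod * (u.map (nilpotentPart X Y c V W)).prod * W
          - c • (V * (w.map X).prod * W * Y j *
            (V * (([] : List ι).map X).prod * (u.map (nilpotentPart X Y c V W)).prod * W)) := by
      simp [nilpotentPart, Matrix.mul_sub, Matrix.sub_mul, Matrix.mul_assoc]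
    rw [hsplit]
    rcases eq_or_ne u [] with rfl | hne
    · have h₁ := hred (w ++ [j])
      have h₂ := hred []
      simp only [List.map_nil, List.prod_nil, Matrix.mul_one, List.length_nil, pow_zero,
        one_smul] at h₂ ⊢
      rw [h₁, hred w, h₂]
      simp [pow_succ', smul_smul]
    · rw [ih hne, ih hne]
      simp

theorem prod_mul_prod_nilpotentPart_mul
    (hred : ∀ w : List ι, V * (w.map X).prod * W = c ^ w.length • (w.map Y).prod)
    (w u : List ι) (hu : u ≠ []) :
    (w.map X).prod * (u.map (nilpotentPart X Y c V W)).prod * W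
      = ((w ++ u).map (nilpotentPart X Y c V W)).prod * W := by
  induction w with
  | nil => simp
  | cons j w ih =>
    have hX : X j = nilpotentPart X Y c V W j + c • (W * Y j * V) := by
      simp [nilpotentPart]
    have h₀ := mul_prod_mul_prod_nilpotentPart_mul hred u hu w
    simp only [List.map_cons, List.prod_cons, List.cons_append]
    rw [Matrix.mul_assoc (nilpotentPart X Y c V W j), ← ih]
    simp only [Matrix.mul_assoc] at h₀ ⊢
    rw [hX, Matrix.add_mul]
    simp [Matrix.mul_assoc, h₀]

theorem broken_zipper
    (hred : ∀ w : List ι, V * (w.map X).prod * W = c ^ w.length • (w.map Y).prod)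
    {N₀ : ℕ} (hnil : ∀ w : List ι, w.length = N₀ →
      (w.map (nilpotentPart X Y c V W)).prod = 0)
    (w : List ι) (hw : N₀ ≤ w.length) (j : ι) :
    (w.map X).prod * X j * W = c • ((w.map X).prod * W * Y j) := by
  have hV : V * W = 1 := by simpa using hred []
  have h := prod_mul_prod_nilpotentPart_mul hred w [j] (by simp)
  have hzero : ((w ++ [j]).map (nilpotentPart X Y c V W)).prod = 0 := by
    rw [← List.take_append_drop N₀ (w ++ [j]), List.map_append, List.prod_append,
      hnil _ (by simp only [List.length_take, List.length_append]; omega), Matrix.zero_mul]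
  rw [hzero, Matrix.zero_mul] at h
  simpa [nilpotentPart, Matrix.mul_sub, Matrix.sub_mul, Matrix.mul_assoc, hV, sub_eq_zero]
    using h

end BrokenZipper

/-- Proposition 5 of the paper (the broken zipper condition): if `(V, W)` is a reduction
with constant `c` from `X` to `Y` whose nilpotent parts `N^(i) = X^(i) - c•(W·Y^(i)·V)`
satisfy that every product of `N₀` of them vanishes, then for every `m > N₀` and every word,
`X^(i₁)⋯X^(iₘ)·X^(i_{m+1})·W = c • (X^(i₁)⋯X^(iₘ)·W·Y^(i_{m+1}))`. -/
theorem stmt_6 (D a b : ℕ) (hD : 0 < D) (ha : 0 < a) (hb : 0 < b)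
    (X : Fin D → Matrix (Fin a) (Fin a) ℂ)
    (Y : Fin D → Matrix (Fin b) (Fin b) ℂ)
    (c : ℂ)
    (V : Matrix (Fin b) (Fin a) ℂ) (W : Matrix (Fin a) (Fin b) ℂ)
    (hVW : V * W = 1)
    (hred : ∀ m : ℕ, 1 ≤ m → ∀ i : Fin m → Fin D,
      V * (List.ofFn fun l : Fin m => X (i l)).prod * W
        = c ^ m • (List.ofFn fun l : Fin m => Y (i l)).prod)
    (N₀ : ℕ)
    (hnil : ∀ i : Fin N₀ → Fin D,
      (List.ofFn fun l : Fin N₀ => X (i l) - c • (W * Y (i l) * V)).prod = 0) :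
    ∀ m : ℕ, N₀ < m → ∀ i : Fin (m + 1) → Fin D,
      (List.ofFn fun l : Fin m => X (i l.castSucc)).prod * X (i (Fin.last m)) * W
        = c • ((List.ofFn fun l : Fin m => X (i l.castSucc)).prod * W * Y (i (Fin.last m))) := by
  intro m hm i
  have hred' : ∀ w : List (Fin D), V * (w.map X).prod * W
      = c ^ w.length • (w.map Y).prod := by
    intro w
    rcases Nat.eq_zero_or_pos w.length with h | h
    · obtain rfl := List.length_eq_zero_iff.mp h
      simpa using hVW
    · simpa [← Function.comp_def, ← List.map_ofFn] using hred w.length h w.get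
  have hnil' : ∀ w : List (Fin D), w.length = N₀ →
      (w.map (nilpotentPart X Y c V W)).prod = 0 := by
    rintro w rfl
    have h := hnil w.get
    change (List.ofFn (nilpotentPart X Y c V W ∘ w.get)).prod = 0 at h
    rwa [← List.map_ofFn, List.ofFn_get] at h
  have h := broken_zipper hred' hnil' (List.ofFn fun l : Fin m => i l.castSucc)
    (by simpa using hm.le) (i (Fin.last m))
  simpa only [List.map_ofFn, Function.comp_def] using h
end

section
/- Let D, a, b be positive integers, X : Fin D → Matrix (Fin a) (Fin a) ℂ, and let Y : Fin D → Matrix (Fin b) (Fin b) ℂ be normal, meaning there exists ℓ ≥ 1 such that the linear map sending M ∈ Matrix (Fin b) (Fin b) ℂ to the family of numbers (trace(M·Y^(i₁)·Y^(i₂)⋯Y^(i_ℓ)))_{i : Fin ℓ → Fin D} is injective. Let c ∈ ℂ, c ≠ 0, and let (V, W) and (Ṽ, W̃) be two reductions from X to Y with the same constant c (so V·W = 1 = Ṽ·W̃, and V·X^(i₁)⋯X^(iₘ)·W = c^m • Y^(i₁)⋯Y^(iₘ) = Ṽ·X^(i₁)⋯X^(iₘ)·W̃ for all m ≥ 1 and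 all words). Let N₀ ∈ ℕ be such that every product of N₀ of the matrices X^(i) − c•(W·Y^(i)·V) vanishes and every product of N₀ of the matrices X^(i) − c•(W̃·Y^(i)·Ṽ) vanishes. Then there exists λ ∈ ℂ, λ ≠ 0, such that for every n > 2·N₀ and every word i : Fin n → Fin D: V·X^(i₁)⋯X^(iₙ) = λ • (Ṽ·X^(i₁)⋯X^(iₙ)) and X^(i₁)⋯X^(iₙ)·W = λ⁻¹ • (X^(i₁)⋯X^(iₙ)·W̃). -/
open Matrix

/-- If the functionals `M ↦ tr (M * z t)` separate matrices, then the `z t` span all matrices. -/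
lemma span_range_eq_top_of_trace_injective {K n T : Type*} [Field K] [Fintype n] [DecidableEq n]
    (z : T → Matrix n n K)
    (hz : Function.Injective fun (M : Matrix n n K) (t : T) => (M * z t).trace) :
    Submodule.span K (Set.range z) = ⊤ := by
  by_contra hne
  obtain ⟨f, hf, hle⟩ := Submodule.exists_le_ker_of_lt_top _ (lt_top_iff_ne_top.2 hne)
  let M : Matrix n n K := Matrix.of fun i j => f (Matrix.single j i 1)
  have hM : ∀ B : Matrix n n K, (M * B).trace = f B := by
    intro B
    conv_rhs => rw [Matrix.matrix_eq_sum_single B]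
    simp only [map_sum, Matrix.trace, Matrix.diag, Matrix.mul_apply]
    rw [Finset.sum_comm]
    refine Finset.sum_congr rfl fun i _ => Finset.sum_congr rfl fun j _ => ?_
    have : Matrix.single i j (B i j) = B i j • Matrix.single i j (1 : K) := by
      simp [Matrix.smul_single]
    rw [this, map_smul, smul_eq_mul, mul_comm]
    rfl
  have hM0 : M = 0 := hz <| funext fun t => by
    have : f (z t) = 0 := hle (Submodule.subset_span ⟨t, rfl⟩)
    simp [hM, this]
  refine hf (LinearMap.ext fun B => ?_)
  rw [← hM, hM0]
  simp

section Span

variable {K A ι T : Type*} [Field K] [Ring A] [Algebra K A]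

/-- If words of one positive length span an algebra, so do all words of length at least `k`. -/
lemma span_long_words_eq_top (Y : ι → A) {l : ℕ} (hl : 1 ≤ l)
    (h : Submodule.span K {M | ∃ w : List ι, w.length = l ∧ (w.map Y).prod = M} = ⊤) (k : ℕ) :
    Submodule.span K {M | ∃ w : List ι, k ≤ w.length ∧ (w.map Y).prod = M} = ⊤ := by
  induction k with
  | zero =>
    refine top_le_iff.1 (h.symm.le.trans (Submodule.span_mono ?_))
    rintro _ ⟨w, -, rfl⟩
    exact ⟨w, Nat.zero_le _, rfl⟩
  | succ k ih =>
    have hmul : (⊤ : Submodule K A) ≤ ⊤ * ⊤ := fun x _ => by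
      simpa using Submodule.mul_mem_mul (Submodule.mem_top (x := x))
        (Submodule.mem_top (R := K) (x := (1 : A)))
    refine top_le_iff.1 (hmul.trans ?_)
    nth_rewrite 1 [← ih]
    rw [← h, Submodule.span_mul_span]
    refine Submodule.span_mono ?_
    rintro _ ⟨_, ⟨u, hu, rfl⟩, _, ⟨v, hv, rfl⟩, rfl⟩
    exact ⟨u ++ v, by rw [List.length_append]; omega, by simp⟩

/-- A family intertwined with a spanning family of a central algebra is a multiple of it. -/
lemma exists_eq_smul_of_intertwine [Algebra.IsCentral K A] (z f : T → A)
    (hz : Submodule.span K (Set.range z) = ⊤) (h : ∀ u v, z u * f v = f u * z v) :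
    ∃ r : K, ∀ v, f v = r • z v := by
  have key : ∀ M : A, ∃ k : A, ∀ v, M * f v = k * z v := by
    intro M
    have hM : M ∈ Submodule.span K (Set.range z) := hz ▸ Submodule.mem_top
    induction hM using Submodule.span_induction with
    | mem _ hx => obtain ⟨u, rfl⟩ := hx; exact ⟨f u, h u⟩
    | zero => exact ⟨0, by simp⟩
    | add x y _ _ hx hy =>
      obtain ⟨k, hk⟩ := hx
      obtain ⟨k', hk'⟩ := hy
      exact ⟨k + k', fun v => by rw [add_mul, add_mul, hk, hk']⟩
    | smul r x _ hx =>
      obtain ⟨k, hk⟩ := hx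
      exact ⟨r • k, fun v => by rw [smul_mul_assoc, smul_mul_assoc, hk]⟩
  obtain ⟨k, hk⟩ := key 1
  simp only [one_mul] at hk
  have hcomm : ∀ u, z u * k = k * z u := by
    intro u
    have : LinearMap.mulLeft K (z u * k) = LinearMap.mulLeft K (k * z u) := by
      refine LinearMap.ext_on_range hz fun v => ?_
      simpa [hk, mul_assoc] using h u v
    simpa using LinearMap.congr_fun this 1
  have hcent : k ∈ Subalgebra.center K A := by
    rw [Subalgebra.mem_center_iff]
    have : LinearMap.mulRight K k = LinearMap.mulLeft K k :=
      LinearMap.ext_on_range hz fun v => by simpa using hcomm v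
    intro b
    simpa using LinearMap.congr_fun this b
  obtain ⟨r, hr⟩ := (Algebra.IsCentral.mem_center_iff K).1 hcent
  exact ⟨r, fun v => by rw [hk, hr, Algebra.smul_def]⟩

end Span

section Reduction

variable {K ι n m : Type*} [Field K] [Fintype n] [DecidableEq n] [Fintype m] [DecidableEq m]

/-- `(V, W)` reduces `X` to `Z`, and words of length `k` in the remainders
`X i - W * Z i * V` vanish. -/
structure IsNilReduction (X : ι → Matrix n n K) (Z : ι → Matrix m m K)
    (V : Matrix m n K) (W : Matrix n m K) (k : ℕ) : Prop where
  mul_eq_one : V * W = 1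
  word : ∀ w : List ι, V * (w.map X).prod * W = (w.map Z).prod
  nil : ∀ w : List ι, w.length = k → (w.map fun i => X i - W * Z i * V).prod = 0

namespace IsNilReduction

variable {X : ι → Matrix n n K} {Z : ι → Matrix m m K}
  {V V' : Matrix m n K} {W W' : Matrix n m K} {k : ℕ}

lemma nil_of_le (h : IsNilReduction X Z V W k) {w : List ι} (hw : k ≤ w.length) :
    (w.map fun i => X i - W * Z i * V).prod = 0 := by
  rw [← List.take_append_drop k w, List.map_append, List.prod_append,
    h.nil _ (by simpa using hw), zero_mul]

lemma remainder_mul_word (h : IsNilReduction X Z V W k) {w : List ι} (hw : w ≠ []) (u : List ι) :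
    V * (w.map fun i => X i - W * Z i * V).prod * (u.map X).prod * W = 0 := by
  induction w using List.reverseRecOn generalizing u with
  | nil => exact absurd rfl hw
  | append_singleton w i ih =>
    rw [List.map_append, List.prod_append]
    simp only [List.map_cons, List.map_nil, List.prod_cons, List.prod_nil, mul_one]
    have e1 := h.word (i :: u)
    have e2 := h.word u
    rw [List.map_cons, List.prod_cons] at e1
    rcases eq_or_ne w [] with rfl | hne
    · have e3 : V * (X i - W * Z i * V) * (u.map X).prod * W
          = V * (X i * (u.map X).prod) * W - V * W * Z i * (V * (u.map X).prod * W) := by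
        simp only [Matrix.mul_sub, Matrix.sub_mul, Matrix.mul_assoc]
      simp only [List.map_nil, List.prod_nil, one_mul]
      rw [e3, e1, e2, h.mul_eq_one, Matrix.one_mul, List.map_cons, List.prod_cons]
      exact sub_self _
    · have f1 := ih hne (i :: u)
      have f2 := ih hne []
      simp only [List.map_cons, List.prod_cons, List.map_nil, List.prod_nil] at f1 f2
      rw [Matrix.mul_one] at f2
      generalize (w.map fun i => X i - W * Z i * V).prod = P at f1 f2 ⊢
      have e3 : V * (P * (X i - W * Z i * V)) * (u.map X).prod * W
          = V * P * (X i * (u.map X).prod) * W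
            - V * P * W * (Z i * (V * (u.map X).prod * W)) := by
        simp only [Matrix.mul_sub, Matrix.sub_mul, Matrix.mul_assoc]
      rw [e3, f1, f2, Matrix.zero_mul, sub_zero]

lemma mul_remainder_mul (h : IsNilReduction X Z V W k) {w : List ι} (hw : w ≠ []) :
    V * (w.map fun i => X i - W * Z i * V).prod * W = 0 := by
  simpa using h.remainder_mul_word hw []

lemma remainder_mul_eq (h : IsNilReduction X Z V W k) {w : List ι} (hw : w ≠ []) (u : List ι) :
    V * (w.map fun i => X i - W * Z i * V).prod * (u.map X).prod
      = V * ((w ++ u).map fun i => X i - W * Z i * V).prod := by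
  induction u generalizing w with
  | nil => simp
  | cons i u ih =>
    have e := ih (w := w ++ [i]) (by simp)
    have f := h.mul_remainder_mul hw
    rw [List.append_assoc, List.singleton_append, List.map_append, List.prod_append] at e
    rw [← e]
    simp only [List.map_cons, List.prod_cons, List.map_nil, List.prod_nil, mul_one]
    generalize (w.map fun i => X i - W * Z i * V).prod = P at f ⊢
    have e3 : V * (P * (X i - W * Z i * V)) * (u.map X).prod
        = V * P * (X i * (u.map X).prod) - V * P * W * (Z i * (V * (u.map X).prod)) := by
      simp only [Matrix.mul_sub, Matrix.sub_mul, Matrix.mul_assoc]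
    rw [e3, f, Matrix.zero_mul, sub_zero]

lemma mul_remainder_eq (h : IsNilReduction X Z V W k) {w : List ι} (hw : w ≠ []) (u : List ι) :
    (u.map X).prod * (w.map fun i => X i - W * Z i * V).prod * W
      = ((u ++ w).map fun i => X i - W * Z i * V).prod * W := by
  induction u using List.reverseRecOn generalizing w with
  | nil => simp
  | append_singleton u i ih =>
    have e := ih (w := i :: w) (by simp)
    have f := h.mul_remainder_mul hw
    rw [List.append_assoc, List.singleton_append, ← e]
    simp only [List.map_append, List.prod_append, List.map_cons, List.prod_cons, List.map_nil,
      List.prod_nil, mul_one]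
    generalize (w.map fun i => X i - W * Z i * V).prod = P at f ⊢
    have e3 : (u.map X).prod * ((X i - W * Z i * V) * P) * W
        = (u.map X).prod * X i * P * W - (u.map X).prod * W * Z i * (V * P * W) := by
      simp only [Matrix.mul_sub, Matrix.sub_mul, Matrix.mul_assoc]
    rw [e3, f, Matrix.mul_zero, sub_zero]

lemma left_append (h : IsNilReduction X Z V W k) (w : List ι) {u : List ι} (hu : k ≤ u.length) :
    V * ((w ++ u).map X).prod = (w.map Z).prod * (V * (u.map X).prod) := by
  induction w with
  | nil => simp
  | cons i w ih =>
    have e := h.remainder_mul_eq (w := [i]) (by simp) (w ++ u)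
    rw [h.nil_of_le (w := [i] ++ (w ++ u)) (by simp; omega), Matrix.mul_zero] at e
    simp only [List.map_cons, List.prod_cons, List.map_nil, List.prod_nil, mul_one] at e
    rw [List.cons_append, List.map_cons, List.prod_cons, List.map_cons, List.prod_cons,
      Matrix.mul_assoc (Z i), ← ih]
    generalize ((w ++ u).map X).prod = P at e ⊢
    have e3 : V * (X i - W * Z i * V) * P = V * (X i * P) - V * W * (Z i * (V * P)) := by
      simp only [Matrix.mul_sub, Matrix.sub_mul, Matrix.mul_assoc]
    rw [e3, h.mul_eq_one, Matrix.one_mul] at e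
    exact sub_eq_zero.1 e

lemma right_append (h : IsNilReduction X Z V W k) (w : List ι) {u : List ι} (hu : k ≤ u.length) :
    ((u ++ w).map X).prod * W = (u.map X).prod * W * (w.map Z).prod := by
  induction w using List.reverseRecOn with
  | nil => simp
  | append_singleton w i ih =>
    have e := h.mul_remainder_eq (w := [i]) (by simp) (u ++ w)
    rw [h.nil_of_le (w := u ++ w ++ [i]) (by simp; omega), Matrix.zero_mul] at e
    rw [← List.append_assoc, List.map_append, List.prod_append, List.map_append (f := Z),
      List.prod_append, ← Matrix.mul_assoc _ (List.prod _) (List.prod _), ← ih]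
    simp only [List.map_cons, List.prod_cons, List.map_nil, List.prod_nil, mul_one] at e ⊢
    generalize ((u ++ w).map X).prod = P at e ⊢
    have e3 : P * (X i - W * Z i * V) * W = P * X i * W - P * W * Z i * (V * W) := by
      simp only [Matrix.mul_sub, Matrix.sub_mul, Matrix.mul_assoc]
    rw [e3, h.mul_eq_one, Matrix.mul_one] at e
    exact sub_eq_zero.1 e

/-- A sufficiently long word factors through the reduced space. -/
lemma factor (h : IsNilReduction X Z V W k) {w u : List ι} (hw : k ≤ w.length)
    (hu : k ≤ u.length) :
    ((w ++ u).map X).prod = (w.map X).prod * W * (V * (u.map X).prod) := by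
  have key : ∀ w : List ι, (w.map X).prod * ((1 - W * V) * (u.map X).prod)
      = (w.map fun i => X i - W * Z i * V).prod * ((1 - W * V) * (u.map X).prod) := by
    intro w
    induction w with
    | nil => simp
    | cons i w ih =>
      have e := h.left_append w hu
      have f := h.word w
      rw [List.map_append, List.prod_append] at e
      rw [List.map_cons, List.prod_cons, List.map_cons, List.prod_cons,
        Matrix.mul_assoc _ _ (_ * _), Matrix.mul_assoc _ _ (_ * _), ← ih]
      have g : V * ((w.map X).prod * ((1 - W * V) * (u.map X).prod)) = 0 := by
        have : V * ((w.map X).prod * ((1 - W * V) * (u.map X).prod))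
            = V * ((w.map X).prod * (u.map X).prod)
              - V * (w.map X).prod * W * (V * (u.map X).prod) := by
          simp only [Matrix.mul_sub, Matrix.sub_mul, Matrix.mul_assoc, Matrix.one_mul]
        rw [this, e, f, sub_self]
      rw [Matrix.sub_mul (X i), Matrix.mul_assoc _ V, g, Matrix.mul_zero, sub_zero]
  have e := key w
  rw [h.nil_of_le hw, Matrix.zero_mul, Matrix.sub_mul, Matrix.mul_sub, sub_eq_zero] at e
  rw [List.map_append, List.prod_append]
  simpa [Matrix.mul_assoc] using e

/-- Two reductions to a family whose long words span agree on long words up to a scalar. -/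
lemma exists_smul_eq [Nonempty m] (h : IsNilReduction X Z V W k)
    (h' : IsNilReduction X Z V' W' k)
    (hZ : ∀ k : ℕ,
      Submodule.span K {M | ∃ w : List ι, k ≤ w.length ∧ (w.map Z).prod = M} = ⊤) :
    ∃ r : K, r ≠ 0 ∧ ∀ w : List ι, 2 * k ≤ w.length →
      V * (w.map X).prod = r • (V' * (w.map X).prod) ∧
      (w.map X).prod * W = r⁻¹ • ((w.map X).prod * W') := by
  have hspan : Submodule.span K
      (Set.range fun w : {w : List ι // k ≤ w.length} => (w.1.map Z).prod) = ⊤ := by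
    rw [← hZ k]
    congr 1
    ext M
    simp
  obtain ⟨r, hr⟩ := exists_eq_smul_of_intertwine _
    (fun w : {w : List ι // k ≤ w.length} => V * (w.1.map X).prod * W') hspan (by
      rintro ⟨u, hu⟩ ⟨v, hv⟩
      have e := h.left_append u hv
      have e' := h'.right_append v hu
      change (u.map Z).prod * (V * (v.map X).prod * W') = V * (u.map X).prod * W' * (v.map Z).prod
      rw [← Matrix.mul_assoc, ← e, Matrix.mul_assoc, e', Matrix.mul_assoc V,
        ← Matrix.mul_assoc V])
  have hsplit : ∀ w : List ι, 2 * k ≤ w.length →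
      ∃ u v : List ι, w = u ++ v ∧ k ≤ u.length ∧ k ≤ v.length := fun w hw =>
    ⟨w.take k, w.drop k, (List.take_append_drop k w).symm, by simp; omega, by simp; omega⟩
  have hV : ∀ w : List ι, 2 * k ≤ w.length →
      V * (w.map X).prod = r • (V' * (w.map X).prod) := by
    intro w hw
    obtain ⟨u, v, rfl, hu, hv⟩ := hsplit w hw
    rw [h'.left_append u hv, h'.factor hu hv, ← Matrix.mul_assoc, ← Matrix.mul_assoc V]
    have := hr ⟨u, hu⟩
    dsimp only at this
    rw [this, Matrix.smul_mul]
  have hW : ∀ w : List ι, 2 * k ≤ w.length →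
      (w.map X).prod * W' = r • ((w.map X).prod * W) := by
    intro w hw
    obtain ⟨u, v, rfl, hu, hv⟩ := hsplit w hw
    rw [h.right_append v hu, h.factor hu hv, Matrix.mul_assoc _ _ W']
    have := hr ⟨v, hv⟩
    dsimp only at this
    rw [this, Matrix.mul_smul]
  have hr0 : r ≠ 0 := by
    rintro rfl
    refine (bot_ne_top : (⊥ : Submodule K (Matrix m m K)) ≠ ⊤) ?_
    rw [← hZ (2 * k), eq_comm, Submodule.span_eq_bot]
    rintro _ ⟨w, hw, rfl⟩
    rw [← h.word, hV w hw, zero_smul, Matrix.zero_mul]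
  exact ⟨r, hr0, fun w hw => ⟨hV w hw, by rw [hW w hw, smul_smul, inv_mul_cancel₀ hr0, one_smul]⟩⟩

end IsNilReduction

lemma prod_map_smul (c : K) (Y : ι → Matrix m m K) (w : List ι) :
    (w.map fun i => c • Y i).prod = c ^ w.length • (w.map Y).prod := by
  induction w with
  | nil => simp
  | cons i w ih => simp [ih, smul_smul, pow_succ]

/-- A reduction with constant `c` to `Y` is a reduction to `c • Y`. -/
lemma isNilReduction_smul {X : ι → Matrix n n K} {Y : ι → Matrix m m K} {c : K}
    {V : Matrix m n K} {W : Matrix n m K} {k : ℕ} (hVW : V * W = 1)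
    (hred : ∀ l : ℕ, 1 ≤ l → ∀ i : Fin l → ι,
      V * (List.ofFn fun j : Fin l => X (i j)).prod * W
        = c ^ l • (List.ofFn fun j : Fin l => Y (i j)).prod)
    (hnil : ∀ i : Fin k → ι,
      (List.ofFn fun j : Fin k => X (i j) - c • (W * Y (i j) * V)).prod = 0) :
    IsNilReduction X (fun i => c • Y i) V W k where
  mul_eq_one := hVW
  word w := by
    rw [prod_map_smul]
    rcases eq_or_ne w [] with rfl | hw
    · simp [hVW]
    · have := hred w.length (List.length_pos_iff.2 hw) w.get
      change V * (List.ofFn (X ∘ w.get)).prod * W = _ • (List.ofFn (Y ∘ w.get)).prod at this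
      rwa [← List.map_ofFn, ← List.map_ofFn, List.ofFn_get] at this
  nil w hw := by
    subst hw
    have e : (fun j => X (w.get j) - c • (W * Y (w.get j) * V))
        = (fun i => X i - W * (c • Y i) * V) ∘ w.get := by
      funext j
      simp
    have := hnil w.get
    rwa [e, ← List.map_ofFn, List.ofFn_get] at this

end Reduction

/-- Theorem 22 of [MGSC18] (uniqueness of reductions): two reductions `(V, W)` and
`(V', W')` with the same constant `c ≠ 0` from `X` to a normal family `Y`, whose nilpotent
parts vanish in products of length `N₀`, agree up to a nonzero scalar `λ` once multiplied
by more than `2·N₀` of the matrices `X^(i)`. -/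
theorem stmt_7 (D a b : ℕ) (hD : 0 < D) (ha : 0 < a) (hb : 0 < b)
    (X : Fin D → Matrix (Fin a) (Fin a) ℂ)
    (Y : Fin D → Matrix (Fin b) (Fin b) ℂ)
    (hnormal : ∃ ℓ : ℕ, 1 ≤ ℓ ∧ Function.Injective
      (fun M : Matrix (Fin b) (Fin b) ℂ =>
        fun i : Fin ℓ → Fin D => (M * (List.ofFn fun l : Fin ℓ => Y (i l)).prod).trace))
    (c : ℂ) (hc : c ≠ 0)
    (V : Matrix (Fin b) (Fin a) ℂ) (W : Matrix (Fin a) (Fin b) ℂ)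
    (V' : Matrix (Fin b) (Fin a) ℂ) (W' : Matrix (Fin a) (Fin b) ℂ)
    (hVW : V * W = 1) (hVW' : V' * W' = 1)
    (hred : ∀ m : ℕ, 1 ≤ m → ∀ i : Fin m → Fin D,
      V * (List.ofFn fun l : Fin m => X (i l)).prod * W
        = c ^ m • (List.ofFn fun l : Fin m => Y (i l)).prod)
    (hred' : ∀ m : ℕ, 1 ≤ m → ∀ i : Fin m → Fin D,
      V' * (List.ofFn fun l : Fin m => X (i l)).prod * W'
        = c ^ m • (List.ofFn fun l : Fin m => Y (i l)).prod)
    (N₀ : ℕ)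
    (hnil : ∀ i : Fin N₀ → Fin D,
      (List.ofFn fun l : Fin N₀ => X (i l) - c • (W * Y (i l) * V)).prod = 0)
    (hnil' : ∀ i : Fin N₀ → Fin D,
      (List.ofFn fun l : Fin N₀ => X (i l) - c • (W' * Y (i l) * V')).prod = 0) :
    ∃ lam : ℂ, lam ≠ 0 ∧ ∀ n : ℕ, 2 * N₀ < n → ∀ i : Fin n → Fin D,
      V * (List.ofFn fun l : Fin n => X (i l)).prod
        = lam • (V' * (List.ofFn fun l : Fin n => X (i l)).prod) ∧
      (List.ofFn fun l : Fin n => X (i l)).prod * W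
        = lam⁻¹ • ((List.ofFn fun l : Fin n => X (i l)).prod * W') := by
  obtain ⟨l, hl, hinj⟩ := hnormal
  have : Nonempty (Fin b) := ⟨⟨0, hb⟩⟩
  have hspan : Submodule.span ℂ
      {M | ∃ w : List (Fin D), w.length = l ∧ (w.map fun i => c • Y i).prod = M} = ⊤ := by
    have hz : Function.Injective fun (M : Matrix (Fin b) (Fin b) ℂ) (i : Fin l → Fin D) =>
        (M * ((List.ofFn i).map fun j => c • Y j).prod).trace := by
      intro M M' h
      refine hinj (funext fun i => ?_)
      have := congrFun h i
      simp only [prod_map_smul, Matrix.mul_smul, Matrix.trace_smul, List.length_ofFn] at this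
      simpa only [List.map_ofFn, Function.comp_def] using
        smul_right_injective ℂ (pow_ne_zero l hc) this
    refine top_le_iff.1
      ((span_range_eq_top_of_trace_injective _ hz).symm.le.trans (Submodule.span_mono ?_))
    rintro _ ⟨i, rfl⟩
    exact ⟨List.ofFn i, by simp, rfl⟩
  obtain ⟨r, hr, h⟩ := (isNilReduction_smul hVW hred hnil).exists_smul_eq
    (isNilReduction_smul hVW' hred' hnil') (span_long_words_eq_top _ hl hspan)
  refine ⟨r, hr, fun n hn i => ?_⟩
  simpa only [List.map_ofFn, Function.comp_def] using h (List.ofFn i) (by simp; omega)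
end

section
/- Let D, n be positive integers, C : Fin D → Fin D → Matrix (Fin n) (Fin n) ℂ a family of matrices, c ∈ ℂ with c ≠ 0, V ∈ Matrix (Fin 1) (Fin n) ℂ and W ∈ Matrix (Fin n) (Fin 1) ℂ with V·W = 1 and V·C^(i₁j₁)·C^(i₂j₂)⋯C^(iₘjₘ)·W = (c^m · ∏_l (if i_l = j_l then 1 else 0)) • 1 for every m ≥ 1 and all words i, j : Fin m → Fin D (a reduction from C to the trivial one-dimensional tensor δ^(ij)). Suppose N₀ ∈ ℕ is such that every product of N₀ of the matrices N^(ij) := C^(ij) − (c · (if i = j then 1 else 0)) • (W·V) vanishes. Put T := (c·D)⁻¹ • ∑_{i ∈ Fin D} C^(ii). Then Λᴿ := T^(N₀)·W satisfies T·Λᴿ = Λᴿ and V·Λᴿ = 1 (in particular Λᴿ ≠ 0), and Λᴸ := V·T^(N₀) satisfies Λᴸ·T = Λᴸ and Λᴸ·W = 1 (in particular Λᴸ ≠ 0). -/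
open Matrix

theorem sum_pow_eq_sum_list_prod {R ι : Type*} [Semiring R] [Fintype ι] (f : ι → R) (m : ℕ) :
    (∑ i, f i) ^ m = ∑ w : Fin m → ι, (List.ofFn fun l => f (w l)).prod := by
  induction m with
  | zero => simp
  | succ m ih =>
    rw [pow_succ', ih, ← (Fin.consEquiv fun _ : Fin (m + 1) => ι).sum_comp,
      Fintype.sum_prod_type, Finset.sum_mul_sum]
    simp [Fin.consEquiv, List.ofFn_succ]

section FixedPoint

variable {R n k : Type*} [CommRing R] [Fintype n] [DecidableEq n] [Fintype k] [DecidableEq k]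
  {T : Matrix n n R} {V : Matrix k n R} {W : Matrix n k R} {N : ℕ}

theorem Matrix.mul_pow_mul_eq_of_sub_pow_eq_zero (h : ∀ m, V * (T ^ m * W) = 1)
    (hN : (T - W * V) ^ N = 0) : T * (T ^ N * W) = T ^ N * W := by
  have key (m : ℕ) : T ^ (m + 1) * W - T ^ m * W = (T - W * V) ^ m * (T * W - W) := by
    induction m with
    | zero => simp
    | succ m ih =>
      rw [pow_succ' (T - W * V), Matrix.mul_assoc, ← ih, Matrix.sub_mul, Matrix.mul_assoc W,
        Matrix.mul_sub V, h, h, sub_self, Matrix.mul_zero, sub_zero, Matrix.mul_sub,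
        ← Matrix.mul_assoc, ← Matrix.mul_assoc, ← pow_succ', ← pow_succ']
  rw [← Matrix.mul_assoc, ← pow_succ', ← sub_eq_zero, key, hN, Matrix.zero_mul]

theorem Matrix.mul_pow_mul_eq_of_sub_pow_eq_zero' (h : ∀ m, V * (T ^ m * W) = 1)
    (hN : (T - W * V) ^ N = 0) : V * T ^ N * T = V * T ^ N := by
  have := Matrix.mul_pow_mul_eq_of_sub_pow_eq_zero (T := Tᵀ) (V := Wᵀ) (W := Vᵀ) (N := N)
    (fun m => by
      rw [← transpose_pow, ← transpose_mul, ← transpose_mul, Matrix.mul_assoc, h, transpose_one])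
    (by rw [← transpose_mul, ← transpose_sub, ← transpose_pow, hN, transpose_zero])
  simpa only [← transpose_pow, ← transpose_mul, transpose_inj] using this

end FixedPoint

/-- Part (i) of the paper's Lemma on fixed points as reductions: for a reduction `(V, W)`
with constant `c` from an MPO tensor `C` to the trivial tensor `δ^(ij)`, with nilpotency
length `N₀`, the tensors `Λᴿ = T^(N₀)·W` and `Λᴸ = V·T^(N₀)` are right and left fixed
points of the 2-transfer matrix `T = (cD)⁻¹ • ∑_i C^(ii)`, normalized by `V·Λᴿ = 1` and
`Λᴸ·W = 1` (in particular nonzero). -/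
theorem stmt_8 (D n : ℕ) (hD : 0 < D) (hn : 0 < n)
    (C : Fin D → Fin D → Matrix (Fin n) (Fin n) ℂ)
    (c : ℂ) (hc : c ≠ 0)
    (V : Matrix (Fin 1) (Fin n) ℂ) (W : Matrix (Fin n) (Fin 1) ℂ)
    (hVW : V * W = 1)
    (hred : ∀ m : ℕ, 1 ≤ m → ∀ i j : Fin m → Fin D,
      V * (List.ofFn fun l : Fin m => C (i l) (j l)).prod * W
        = (c ^ m * ∏ l : Fin m, (if i l = j l then (1 : ℂ) else 0))
            • (1 : Matrix (Fin 1) (Fin 1) ℂ))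
    (N₀ : ℕ)
    (hnil : ∀ i j : Fin N₀ → Fin D,
      (List.ofFn fun l : Fin N₀ =>
        C (i l) (j l) - (c * (if i l = j l then (1 : ℂ) else 0)) • (W * V)).prod = 0) :
    (((c * (D : ℂ))⁻¹ • ∑ i : Fin D, C i i)
        * (((c * (D : ℂ))⁻¹ • ∑ i : Fin D, C i i) ^ N₀ * W)
      = ((c * (D : ℂ))⁻¹ • ∑ i : Fin D, C i i) ^ N₀ * W) ∧
    (V * (((c * (D : ℂ))⁻¹ • ∑ i : Fin D, C i i) ^ N₀ * W) = 1) ∧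
    (((c * (D : ℂ))⁻¹ • ∑ i : Fin D, C i i) ^ N₀ * W ≠ 0) ∧
    ((V * ((c * (D : ℂ))⁻¹ • ∑ i : Fin D, C i i) ^ N₀)
        * ((c * (D : ℂ))⁻¹ • ∑ i : Fin D, C i i)
      = V * ((c * (D : ℂ))⁻¹ • ∑ i : Fin D, C i i) ^ N₀) ∧
    ((V * ((c * (D : ℂ))⁻¹ • ∑ i : Fin D, C i i) ^ N₀) * W = 1) ∧
    (V * ((c * (D : ℂ))⁻¹ • ∑ i : Fin D, C i i) ^ N₀ ≠ 0) := by
  have hD' : (D : ℂ) ≠ 0 := by exact_mod_cast hD.ne'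
  have hscale : (c * (D : ℂ))⁻¹ * D * c = 1 := by field_simp
  set T := (c * (D : ℂ))⁻¹ • ∑ i : Fin D, C i i with hT
  have hexp (m : ℕ) : V * (T ^ m * W) = 1 := by
    rcases Nat.eq_zero_or_pos m with rfl | hm
    · simpa using hVW
    · have hword (w : Fin m → Fin D) :
          V * (List.ofFn fun l => C (w l) (w l)).prod * W = c ^ m • 1 := by
        simpa using hred m hm w w
      rw [hT, smul_pow, sum_pow_eq_sum_list_prod (fun i => C i i), ← Matrix.mul_assoc,
        Matrix.mul_smul, Matrix.smul_mul, Matrix.mul_sum, Matrix.sum_mul]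
      simp only [hword, Finset.sum_const, Finset.card_univ, Fintype.card_pi, Fintype.card_fin,
        Finset.prod_const]
      rw [← Nat.cast_smul_eq_nsmul ℂ, smul_smul, smul_smul, Nat.cast_pow, ← mul_pow, ← mul_pow,
        hscale, one_pow, one_smul]
  have hsub : T - W * V = (c * (D : ℂ))⁻¹ • ∑ i : Fin D, (C i i - c • (W * V)) := by
    rw [Finset.sum_sub_distrib, smul_sub, Finset.sum_const, Finset.card_univ, Fintype.card_fin,
      ← Nat.cast_smul_eq_nsmul ℂ, smul_smul, smul_smul, hscale, one_smul]
  have hzero : (T - W * V) ^ N₀ = 0 := by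
    rw [hsub, smul_pow, sum_pow_eq_sum_list_prod (fun i => C i i - c • (W * V)),
      Finset.sum_eq_zero fun w _ => by simpa using hnil w w, smul_zero]
  have hL : V * T ^ N₀ * W = 1 := by rw [Matrix.mul_assoc, hexp]
  refine ⟨mul_pow_mul_eq_of_sub_pow_eq_zero hexp hzero, hexp N₀, fun h => ?_,
    mul_pow_mul_eq_of_sub_pow_eq_zero' hexp hzero, hL, fun h => ?_⟩
  · simpa [h] using hexp N₀
  · simp [h] at hL
end

section
/- Let D, n, p be positive integers, C : Fin D → Fin D → Matrix (Fin n) (Fin n) ℂ and B : Fin D → Fin D → Matrix (Fin p) (Fin p) ℂ families of matrices, c ∈ ℂ with c ≠ 0, V ∈ Matrix (Fin p) (Fin n) ℂ and W ∈ Matrix (Fin n) (Fin p) ℂ. Assume: V·W = 1; V·C^(i₁j₁)⋯C^(iₘjₘ)·W = c^m • (B^(i₁j₁)⋯B^(iₘjₘ)) for every m ≥ 1 and all words i, j : Fin m → Fin D; there is N₀ ∈ ℕ such that every product of N₀ of the matrices N^(ij) := C^(ij) − c • (W·B^(ij)·V) vanishes; and the normalizations ∑_{i,j} B^(ij)·(B^(ij))ᴴ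 = D • 1 and ∑_{i,j} (B^(ij))ᴴ·B^(ij) = D • 1 hold. Define f on Matrix (Fin n) (Fin p) ℂ by f(M) := (c·D)⁻¹ • ∑_{i,j} C^(ij)·M·(B^(ij))ᴴ, and g on Matrix (Fin p) (Fin n) ℂ by g(M) := (c·D)⁻¹ • ∑_{i,j} (B^(ij))ᴴ·M·C^(ij). Then Λᴿ := f^(N₀)(W) satisfies f(Λᴿ) = Λᴿ and V·Λᴿ = 1 (the p×p identity), and Λᴸ := g^(N₀)(V) satisfies g(Λᴸ) = Λᴸ and Λᴸ·W = 1; in particular both are nonzero. -/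
open Matrix

namespace MPUReduction

variable {K ι ν π : Type*} [Field K] [Fintype ν] [Fintype π]

theorem transpose_prod_map [DecidableEq ν] (A : ι → Matrix ν ν K) (l : List ι) :
    (l.map fun a => (A a)ᵀ).prod = (l.reverse.map A).prodᵀ := by
  simp [Matrix.transpose_list_prod, Function.comp_def]

variable [Fintype ι]

/-- The transfer matrix `M ↦ s • ∑ a, A a * M * B a`. -/
def transfer (s : K) (A : ι → Matrix ν ν K) (B : ι → Matrix π π K) :
    Matrix ν π K →ₗ[K] Matrix ν π K where
  toFun M := s • ∑ a, A a * M * B a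
  map_add' M N := by simp [Matrix.mul_add, Matrix.add_mul, Finset.sum_add_distrib]
  map_smul' r M := by simp [← Finset.smul_sum, smul_comm s r]

theorem transfer_apply (s : K) (A : ι → Matrix ν ν K) (B : ι → Matrix π π K)
    (M : Matrix ν π K) : transfer s A B M = s • ∑ a, A a * M * B a := rfl

theorem transpose_transfer (s : K) (A : ι → Matrix ν ν K) (B : ι → Matrix π π K)
    (M : Matrix ν π K) :
    (transfer s A B M)ᵀ = transfer s (fun a => (B a)ᵀ) (fun a => (A a)ᵀ) Mᵀ := by
  simp [transfer_apply, Matrix.transpose_sum, Matrix.mul_assoc]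

variable [DecidableEq ν]

/-- If all words of length `m` in the matrices `A` annihilate `M`, so does the `m`-th power
of the transfer matrix. -/
theorem transfer_iterate_eq_zero (s : K) (A : ι → Matrix ν ν K) (B : ι → Matrix π π K)
    (m : ℕ) (M : Matrix ν π K)
    (h : ∀ l : List ι, l.length = m → (l.map A).prod * M = 0) :
    (transfer s A B)^[m] M = 0 := by
  induction m generalizing M with
  | zero => simpa using h [] rfl
  | succ m ih =>
    rw [Function.iterate_succ_apply]
    refine ih _ fun l hl => ?_
    rw [transfer_apply, Matrix.mul_smul, Matrix.mul_sum, Finset.sum_eq_zero, smul_zero]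
    intro a _
    have := h (l ++ [a]) (by simp [hl])
    simp only [List.map_append, List.prod_append, List.map_cons, List.map_nil,
      List.prod_singleton] at this
    rw [← Matrix.mul_assoc, ← Matrix.mul_assoc, this, Matrix.zero_mul]

variable [DecidableEq π]

/-- The transfer matrix preserves the right reduction property. -/
theorem reduction_transfer {C : ι → Matrix ν ν K} {B B' : ι → Matrix π π K} {c d : K}
    (hc : c ≠ 0) (hd : d ≠ 0) {V : Matrix π ν K} (hB : ∑ a, B a * B' a = d • 1)
    {M : Matrix ν π K}
    (hM : ∀ l : List ι, V * (l.map C).prod * M = c ^ l.length • (l.map B).prod)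
    (l : List ι) :
    V * (l.map C).prod * transfer (c * d)⁻¹ C B' M = c ^ l.length • (l.map B).prod := by
  have key (a : ι) : V * (l.map C).prod * (C a * M * B' a)
      = c ^ (l.length + 1) • ((l.map B).prod * (B a * B' a)) := by
    have := hM (l ++ [a])
    simp only [List.map_append, List.prod_append, List.map_cons, List.map_nil,
      List.prod_singleton, List.length_append, List.length_singleton] at this
    rw [← Matrix.mul_assoc, ← Matrix.mul_assoc, Matrix.mul_assoc V, this, Matrix.smul_mul,
      Matrix.mul_assoc]
  rw [transfer_apply, Matrix.mul_smul, Matrix.mul_sum, Finset.sum_congr rfl fun a _ => key a,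
    ← Finset.smul_sum, ← Matrix.mul_sum, hB, Matrix.mul_smul, Matrix.mul_one, smul_smul,
    smul_smul]
  congr 1
  rw [pow_succ]
  field_simp

/-- Applying the transfer matrix to a reduction tensor as many times as the nilpotency length
of the remainder `C a - c • (W * B a * V)` produces a normalized fixed point. -/
theorem transfer_iterate_fixed {C : ι → Matrix ν ν K} {B B' : ι → Matrix π π K} {c d : K}
    (hc : c ≠ 0) (hd : d ≠ 0) {V : Matrix π ν K} {W : Matrix ν π K}
    (hB : ∑ a, B a * B' a = d • 1)
    (hred : ∀ l : List ι, V * (l.map C).prod * W = c ^ l.length • (l.map B).prod)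
    {N : ℕ}
    (hnil : ∀ l : List ι, l.length = N →
      (l.map fun a => C a - c • (W * B a * V)).prod = 0) :
    transfer (c * d)⁻¹ C B' ((transfer (c * d)⁻¹ C B')^[N] W)
        = (transfer (c * d)⁻¹ C B')^[N] W ∧
      V * (transfer (c * d)⁻¹ C B')^[N] W = 1 := by
  set f := transfer (c * d)⁻¹ C B'
  set r := transfer (c * d)⁻¹ (fun a => C a - c • (W * B a * V)) B'
  have hiter (m : ℕ) (l : List ι) :
      V * (l.map C).prod * f^[m] W = c ^ l.length • (l.map B).prod := by
    induction m generalizing l with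
    | zero => exact hred l
    | succ m ih =>
      rw [Function.iterate_succ_apply']
      exact reduction_transfer hc hd hB ih l
  have hV (m : ℕ) : V * f^[m] W = 1 := by simpa using hiter m []
  have hsplit (M : Matrix ν π K) (hM : V * M = 1) : f M = r M + W := by
    have key (a : ι) : C a * M * B' a
        = (C a - c • (W * B a * V)) * M * B' a + c • (W * (B a * B' a)) := by
      rw [Matrix.sub_mul, Matrix.sub_mul, Matrix.smul_mul, Matrix.smul_mul,
        Matrix.mul_assoc (W * B a) V, hM, Matrix.mul_one, Matrix.mul_assoc W, sub_add_cancel]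
    simp only [f, r, transfer_apply]
    rw [Finset.sum_congr rfl fun a _ => key a, Finset.sum_add_distrib, smul_add,
      ← Finset.smul_sum, ← Matrix.mul_sum, hB, Matrix.mul_smul, Matrix.mul_one, smul_smul,
      smul_smul, mul_assoc, inv_mul_cancel₀ (mul_ne_zero hc hd), one_smul]
  have hdiff (m : ℕ) : f (f^[m] W) - f^[m] W = r^[m] (r W) := by
    induction m with
    | zero => simp [hsplit W (hV 0)]
    | succ m ih =>
      rw [Function.iterate_succ_apply' r, ← ih, map_sub, Function.iterate_succ_apply',
        hsplit (f (f^[m] W)) (by simpa only [Function.iterate_succ_apply'] using hV (m + 1))]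
      nth_rewrite 2 [hsplit _ (hV m)]
      abel
  refine ⟨sub_eq_zero.mp ?_, hV N⟩
  rw [hdiff]
  exact transfer_iterate_eq_zero _ _ _ _ _ fun l hl => by rw [hnil l hl, Matrix.zero_mul]

end MPUReduction

open MPUReduction in
/-- Part (ii) of the paper's Lemma on fixed points as reductions: for a reduction `(V, W)`
with constant `c` from the composed MPO tensor `C` to the canonically normalized MPU tensor
`B`, with nilpotency length `N₀`, the tensors `Λᴿ = f^[N₀] W` and `Λᴸ = g^[N₀] V` are right
and left fixed points of the `(2,1)`-transfer matrices `f` and `g`, normalized by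
`V·Λᴿ = 1` and `Λᴸ·W = 1` (in particular nonzero). -/
theorem stmt_9 (D n p : ℕ) (hD : 0 < D) (hn : 0 < n) (hp : 0 < p)
    (C : Fin D → Fin D → Matrix (Fin n) (Fin n) ℂ)
    (B : Fin D → Fin D → Matrix (Fin p) (Fin p) ℂ)
    (c : ℂ) (hc : c ≠ 0)
    (V : Matrix (Fin p) (Fin n) ℂ) (W : Matrix (Fin n) (Fin p) ℂ)
    (hVW : V * W = 1)
    (hred : ∀ m : ℕ, 1 ≤ m → ∀ i j : Fin m → Fin D,
      V * (List.ofFn fun l : Fin m => C (i l) (j l)).prod * W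
        = c ^ m • (List.ofFn fun l : Fin m => B (i l) (j l)).prod)
    (N₀ : ℕ)
    (hnil : ∀ i j : Fin N₀ → Fin D,
      (List.ofFn fun l : Fin N₀ =>
        C (i l) (j l) - c • (W * B (i l) (j l) * V)).prod = 0)
    (hBright : ∑ i : Fin D, ∑ j : Fin D, B i j * (B i j)ᴴ = (D : ℂ) • 1)
    (hBleft : ∑ i : Fin D, ∑ j : Fin D, (B i j)ᴴ * B i j = (D : ℂ) • 1)
    (f : Matrix (Fin n) (Fin p) ℂ → Matrix (Fin n) (Fin p) ℂ)
    (hf : ∀ M : Matrix (Fin n) (Fin p) ℂ,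
      f M = (c * (D : ℂ))⁻¹ • ∑ i : Fin D, ∑ j : Fin D, C i j * M * (B i j)ᴴ)
    (g : Matrix (Fin p) (Fin n) ℂ → Matrix (Fin p) (Fin n) ℂ)
    (hg : ∀ M : Matrix (Fin p) (Fin n) ℂ,
      g M = (c * (D : ℂ))⁻¹ • ∑ i : Fin D, ∑ j : Fin D, (B i j)ᴴ * M * C i j) :
    (f (f^[N₀] W) = f^[N₀] W) ∧ (V * f^[N₀] W = 1) ∧ (f^[N₀] W ≠ 0) ∧
    (g (g^[N₀] V) = g^[N₀] V) ∧ ((g^[N₀] V) * W = 1) ∧ (g^[N₀] V ≠ 0) := by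
  have hd : (D : ℂ) ≠ 0 := Nat.cast_ne_zero.mpr hD.ne'
  have : Nonempty (Fin p) := ⟨⟨0, hp⟩⟩
  let C' : Fin D × Fin D → Matrix (Fin n) (Fin n) ℂ := fun a => C a.1 a.2
  let B' : Fin D × Fin D → Matrix (Fin p) (Fin p) ℂ := fun a => B a.1 a.2
  have hofFn {k : ℕ} (A : Fin D × Fin D → Matrix (Fin k) (Fin k) ℂ)
      (l : List (Fin D × Fin D)) :
      (List.ofFn fun t : Fin l.length => A ((l.get t).1, (l.get t).2)) = l.map A := by
    simp
  have hred' (l : List (Fin D × Fin D)) :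
      V * (l.map C').prod * W = c ^ l.length • (l.map B').prod := by
    rcases Nat.eq_zero_or_pos l.length with h | h
    · simp [List.length_eq_zero_iff.mp h, hVW]
    · rw [← hofFn C', ← hofFn B']
      exact hred l.length h (fun t => (l.get t).1) fun t => (l.get t).2
  have hnil' (l : List (Fin D × Fin D)) (hl : l.length = N₀) :
      (l.map fun a => C' a - c • (W * B' a * V)).prod = 0 := by
    subst hl
    rw [← hofFn]
    exact hnil (fun t => (l.get t).1) fun t => (l.get t).2
  have hf' : f = transfer (c * D)⁻¹ C' fun a => (B' a)ᴴ := by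
    ext1 M
    rw [hf, transfer_apply, Fintype.sum_prod_type]
  have hg' : g = transfer (c * D)⁻¹ (fun a => (B' a)ᴴ) C' := by
    ext1 M
    rw [hg, transfer_apply, Fintype.sum_prod_type]
  obtain ⟨hR, hVR⟩ := transfer_iterate_fixed (C := C') (B := B') (B' := fun a => (B' a)ᴴ)
    hc hd (by rw [Fintype.sum_prod_type]; exact hBright) hred' hnil'
  obtain ⟨hL, hLW⟩ := transfer_iterate_fixed (C := fun a => (C' a)ᵀ) (B := fun a => (B' a)ᵀ)
    (B' := fun a => (B' a)ᴴᵀ) (V := Wᵀ) (W := Vᵀ) (N := N₀) hc hd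
    (by
      simp_rw [← Matrix.transpose_mul, ← Matrix.transpose_sum]
      rw [Fintype.sum_prod_type, hBleft]
      simp)
    (fun l => by
      rw [transpose_prod_map, transpose_prod_map, ← Matrix.transpose_smul,
        ← l.length_reverse, ← hred']
      simp [Matrix.mul_assoc])
    (fun l hl => by
      have h := transpose_prod_map (fun a => C' a - c • (W * B' a * V)) l
      rw [hnil' _ (by simpa using hl)] at h
      simpa [Matrix.mul_assoc] using h)
  have hT : Function.Semiconj Matrix.transpose g
      (transfer (c * D)⁻¹ (fun a => (C' a)ᵀ) fun a => (B' a)ᴴᵀ) := fun M => by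
    rw [hg', transpose_transfer]
  rw [← hT.iterate_right N₀ V] at hL hLW
  rw [← hT, Matrix.transpose_inj] at hL
  rw [← Matrix.transpose_mul, Matrix.transpose_eq_one] at hLW
  rw [← hf'] at hR hVR
  refine ⟨hR, hVR, fun h => ?_, hL, hLW, fun h => ?_⟩
  · rw [h, Matrix.mul_zero] at hVR
    exact zero_ne_one hVR
  · rw [h, Matrix.zero_mul] at hLW
    exact zero_ne_one hLW
end

section
/- Let D, n, p be positive integers, C : Fin D → Fin D → Matrix (Fin n) (Fin n) ℂ and B : Fin D → Fin D → Matrix (Fin p) (Fin p) ℂ, c ∈ ℂ with c ≠ 0, V ∈ Matrix (Fin p) (Fin n) ℂ, W ∈ Matrix (Fin n) (Fin p) ℂ. Assume V·W = 1, V·C^(i₁j₁)⋯C^(iₘjₘ)·W = c^m • (B^(i₁j₁)⋯B^(iₘjₘ)) for all m ≥ 1 and all words, and the normalizations ∑_{i,j} B^(ij)·(B^(ij))ᴴ = D • 1 and ∑_{i,j} (B^(ij))ᴴ·B^(ij) = D • 1. Define f(M) := (c·D)⁻¹ • ∑_{i,j} C^(ij)·M·(B^(ij))ᴴ on Matrix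 (Fin n) (Fin p) ℂ and g(M) := (c·D)⁻¹ • ∑_{i,j} (B^(ij))ᴴ·M·C^(ij) on Matrix (Fin p) (Fin n) ℂ. Then for every N ∈ ℕ, setting Λᴿ := f^(N)(W) and Λᴸ := g^(N)(V), the pair (Λᴸ, Λᴿ) is again a reduction from C to B with the same constant c: Λᴸ·Λᴿ = 1 and Λᴸ·C^(i₁j₁)⋯C^(iₘjₘ)·Λᴿ = c^m • (B^(i₁j₁)⋯B^(iₘjₘ)) for every m ≥ 1 and all words i, j : Fin m → Fin D. -/
open Matrix

/-- The pair `(V, W)` reduces every word in the matrices `C`, the empty one included, to the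
corresponding word in the matrices `B`, up to one factor `c` per letter. -/
def IsReductionPair {ι ν π 𝕜 : Type*} [Fintype ν] [DecidableEq ν] [Fintype π] [DecidableEq π]
    [Field 𝕜] (c : 𝕜) (C : ι → Matrix ν ν 𝕜) (B : ι → Matrix π π 𝕜)
    (V : Matrix π ν 𝕜) (W : Matrix ν π 𝕜) : Prop :=
  ∀ w : List ι, V * (w.map C).prod * W = c ^ w.length • (w.map B).prod

namespace IsReductionPair

variable {ι ν π 𝕜 : Type*} [Fintype ι] [Fintype ν] [DecidableEq ν] [Fintype π] [DecidableEq π]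
  [Field 𝕜] {c d : 𝕜} {C : ι → Matrix ν ν 𝕜} {B B' : ι → Matrix π π 𝕜}
  {V : Matrix π ν 𝕜} {W : Matrix ν π 𝕜}

theorem right_transfer (h : IsReductionPair c C B V W) (hc : c ≠ 0) (hd : d ≠ 0)
    (hB : ∑ x, B x * B' x = d • 1) :
    IsReductionPair c C B V ((c * d)⁻¹ • ∑ x, C x * W * B' x) := by
  intro w
  have key (x : ι) : V * (w.map C).prod * (C x * W * B' x)
      = c ^ (w.length + 1) • ((w.map B).prod * (B x * B' x)) := by
    have hx := h (w ++ [x])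
    simp only [List.map_append, List.map_cons, List.map_nil, List.prod_append, List.prod_singleton,
      List.length_append, List.length_singleton] at hx
    rw [← Matrix.mul_assoc _ (B x), ← Matrix.smul_mul, ← hx]
    simp only [Matrix.mul_assoc]
  rw [Matrix.mul_smul, Matrix.mul_sum, Finset.sum_congr rfl fun x _ => key x,
    ← Finset.smul_sum, ← Matrix.mul_sum, hB, Matrix.mul_smul, Matrix.mul_one, smul_smul, smul_smul]
  congr 1
  field_simp
  exact pow_succ' c _

theorem left_transfer (h : IsReductionPair c C B V W) (hc : c ≠ 0) (hd : d ≠ 0)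
    (hB : ∑ x, B' x * B x = d • 1) :
    IsReductionPair c C B ((c * d)⁻¹ • ∑ x, B' x * V * C x) W := by
  intro w
  have key (x : ι) : B' x * V * C x * ((w.map C).prod * W)
      = c ^ (w.length + 1) • (B' x * B x * (w.map B).prod) := by
    have hx := h (x :: w)
    simp only [List.map_cons, List.prod_cons, List.length_cons] at hx
    rw [Matrix.mul_assoc (B' x) (B x), ← Matrix.mul_smul, ← hx]
    simp only [Matrix.mul_assoc]
  rw [Matrix.mul_assoc, Matrix.smul_mul, Matrix.sum_mul, Finset.sum_congr rfl fun x _ => key x,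
    ← Finset.smul_sum, ← Matrix.sum_mul, hB, Matrix.smul_mul, Matrix.one_mul, smul_smul, smul_smul]
  congr 1
  field_simp
  exact pow_succ' c _

end IsReductionPair

/-- Remark after the paper's Lemma on fixed points as reductions: the pair
`(Λᴸ, Λᴿ) = (g^[N] V, f^[N] W)` obtained by applying the left and right `(2,1)`-transfer
matrices to a reduction pair `(V, W)` is again a reduction from `C` to `B` with the same
constant `c`. -/
theorem stmt_10 (D n p : ℕ) (hD : 0 < D) (hn : 0 < n) (hp : 0 < p)
    (C : Fin D → Fin D → Matrix (Fin n) (Fin n) ℂ)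
    (B : Fin D → Fin D → Matrix (Fin p) (Fin p) ℂ)
    (c : ℂ) (hc : c ≠ 0)
    (V : Matrix (Fin p) (Fin n) ℂ) (W : Matrix (Fin n) (Fin p) ℂ)
    (hVW : V * W = 1)
    (hred : ∀ m : ℕ, 1 ≤ m → ∀ i j : Fin m → Fin D,
      V * (List.ofFn fun l : Fin m => C (i l) (j l)).prod * W
        = c ^ m • (List.ofFn fun l : Fin m => B (i l) (j l)).prod)
    (hBright : ∑ i : Fin D, ∑ j : Fin D, B i j * (B i j)ᴴ = (D : ℂ) • 1)
    (hBleft : ∑ i : Fin D, ∑ j : Fin D, (B i j)ᴴ * B i j = (D : ℂ) • 1)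
    (f : Matrix (Fin n) (Fin p) ℂ → Matrix (Fin n) (Fin p) ℂ)
    (hf : ∀ M : Matrix (Fin n) (Fin p) ℂ,
      f M = (c * (D : ℂ))⁻¹ • ∑ i : Fin D, ∑ j : Fin D, C i j * M * (B i j)ᴴ)
    (g : Matrix (Fin p) (Fin n) ℂ → Matrix (Fin p) (Fin n) ℂ)
    (hg : ∀ M : Matrix (Fin p) (Fin n) ℂ,
      g M = (c * (D : ℂ))⁻¹ • ∑ i : Fin D, ∑ j : Fin D, (B i j)ᴴ * M * C i j) :
    ∀ N : ℕ,
      ((g^[N] V) * (f^[N] W) = 1) ∧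
      (∀ m : ℕ, 1 ≤ m → ∀ i j : Fin m → Fin D,
        (g^[N] V) * (List.ofFn fun l : Fin m => C (i l) (j l)).prod * (f^[N] W)
          = c ^ m • (List.ofFn fun l : Fin m => B (i l) (j l)).prod) := by
  have hD' : (D : ℂ) ≠ 0 := Nat.cast_ne_zero.mpr hD.ne'
  let C' : Fin D × Fin D → Matrix (Fin n) (Fin n) ℂ := fun x => C x.1 x.2
  let B' : Fin D × Fin D → Matrix (Fin p) (Fin p) ℂ := fun x => B x.1 x.2
  have base : IsReductionPair c C' B' V W := by
    intro w
    rcases Nat.eq_zero_or_pos w.length with hw | hw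
    · obtain rfl := List.length_eq_zero_iff.mp hw
      simpa using hVW
    · have hofFn {α : Type} (F : Fin D × Fin D → α) :
          (List.ofFn fun l => F (w.get l)) = w.map F := by
        rw [← Function.comp_def F, ← List.map_ofFn, List.ofFn_get]
      rw [← hofFn C', ← hofFn B']
      exact hred w.length hw (fun l => (w.get l).1) (fun l => (w.get l).2)
  have hR : ∑ x, B' x * (B' x)ᴴ = (D : ℂ) • 1 := by rw [Fintype.sum_prod_type]; exact hBright
  have hL : ∑ x, (B' x)ᴴ * B' x = (D : ℂ) • 1 := by rw [Fintype.sum_prod_type]; exact hBleft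
  have hf' (M : Matrix (Fin n) (Fin p) ℂ) :
      f M = (c * (D : ℂ))⁻¹ • ∑ x, C' x * M * (B' x)ᴴ := by
    rw [hf, Fintype.sum_prod_type]
  have hg' (M : Matrix (Fin p) (Fin n) ℂ) :
      g M = (c * (D : ℂ))⁻¹ • ∑ x, (B' x)ᴴ * M * C' x := by
    rw [hg, Fintype.sum_prod_type]
  intro N
  have hN : IsReductionPair c C' B' (g^[N] V) (f^[N] W) := by
    induction N with
    | zero => exact base
    | succ N ih =>
      rw [Function.iterate_succ_apply', Function.iterate_succ_apply', hf', hg']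
      exact (ih.right_transfer hc hD' hR).left_transfer hc hD' hL
  refine ⟨by simpa using hN [], fun m _ i j => ?_⟩
  simpa [List.map_ofFn, Function.comp_def, C', B'] using hN (List.ofFn fun l => (i l, j l))
end

section
/- Define B : Fin 2 → Fin 2 → Matrix (Fin 2) (Fin 2) ℂ by B^(01) = !![1, 1; 0, 0], B^(10) = !![0, 0; 1, −1], and B^(00) = B^(11) = 0. Then for every L ≥ 1 and all functions i, j : ZMod L → Fin 2, trace(B^(i₀j₀)·B^(i₁j₁)⋯B^(i_{L−1}j_{L−1})) = (∏_{l} (if (i_l : ℕ) + (j_l : ℕ) = 1 then 1 else 0)) · (−1)^(∑_{l} (i_l : ℕ)·(i_{l+1} : ℕ)), where the index l + 1 is taken cyclically in ZMod L. Equivalently, the length-L matrix product operator generated by B (with periodic boundary conditions) equals the boundary CZX symmetry operator (∏_{l} CZ_{l,l+1})·(∏_{l} X_l) on the L-fold tensor power of ℂ², where X is the spin flip exchanging the two basis states and CZ_{l,l+1} multiplies the computational basis vector |i⟩ by (−1)^(i_l·i_{l+1}). -/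
open Matrix

/-- The transition MPU tensor `B_Z` of the CZX model. -/
noncomputable def czxB : Fin 2 → Fin 2 → Matrix (Fin 2) (Fin 2) ℂ := fun i j =>
  if i = 0 ∧ j = 1 then !![1, 1; 0, 0]
  else if i = 1 ∧ j = 0 then !![0, 0; 1, -1]
  else 0

theorem czxB_apply (i j a b : Fin 2) :
    czxB i j a b = (if (i : ℕ) + (j : ℕ) = 1 then (1 : ℂ) else 0)
      * (if a = i then 1 else 0) * (-1 : ℂ) ^ ((i : ℕ) * (b : ℕ)) := by
  fin_cases i <;> fin_cases j <;> fin_cases a <;> fin_cases b <;> simp [czxB]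

theorem prod_ofFn_czxB_apply (x y : ℕ → Fin 2) (n : ℕ) (a b : Fin 2) :
    (List.ofFn fun l : Fin (n + 1) => czxB (x l) (y l)).prod a b =
      (∏ l ∈ Finset.range (n + 1), if (x l : ℕ) + (y l : ℕ) = 1 then (1 : ℂ) else 0)
        * (if a = x 0 then 1 else 0)
        * (-1 : ℂ) ^ (∑ l ∈ Finset.range n, (x l : ℕ) * (x (l + 1) : ℕ) + (x n : ℕ) * (b : ℕ)) := by
  induction n generalizing b with
  | zero => simp [czxB_apply]
  | succ n ih =>
    rw [List.ofFn_succ']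
    simp only [List.concat_eq_append, List.prod_append, List.prod_singleton, Fin.val_castSucc,
      Fin.val_last, Matrix.mul_apply, ih, czxB_apply]
    rw [Finset.sum_eq_single (x (n + 1)) (fun c _ hc => by simp [hc]) (by simp),
      Finset.prod_range_succ _ (n + 1), Finset.sum_range_succ _ n, if_pos rfl, pow_add _ (_ + _)]
    ring

@[to_additive]
theorem ZMod.prod_univ_eq_prod_range {M : Type*} [CommMonoid M] (n : ℕ) [NeZero n]
    (f : ZMod n → M) : ∏ l : ZMod n, f l = ∏ l ∈ Finset.range n, f (l : ZMod n) := by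
  refine Finset.prod_bij' (fun l _ => l.val) (fun l _ => (l : ZMod n)) ?_ ?_ ?_ ?_ ?_
  · exact fun l _ => Finset.mem_range.2 l.val_lt
  · simp
  · simp
  · exact fun l hl => ZMod.val_cast_of_lt (Finset.mem_range.1 hl)
  · simp

/-- The length-`L` MPO generated by the CZX transition tensor `B_Z` (periodic boundary
conditions) equals the boundary CZX symmetry operator `(∏ CZ_{l,l+1})·(∏ X_l)`:
its matrix entries are
`trace(B^(i₀j₀)⋯B^(i_{L-1}j_{L-1}))
  = (∏_l [iₗ + jₗ = 1]) · (−1)^(∑_l iₗ·i_{l+1})`, indices cyclic in `ZMod L`. -/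
theorem stmt_11 (L : ℕ) [NeZero L] (i j : ZMod L → Fin 2) :
    ((List.ofFn fun l : Fin L =>
        czxB (i ((l : ℕ) : ZMod L)) (j ((l : ℕ) : ZMod L))).prod).trace
      = (∏ l : ZMod L, if ((i l : ℕ) + (j l : ℕ) = 1) then (1 : ℂ) else 0)
        * (-1 : ℂ) ^ (∑ l : ZMod L, (i l : ℕ) * (i (l + 1) : ℕ)) := by
  obtain ⟨n, rfl⟩ := Nat.exists_eq_succ_of_ne_zero (NeZero.ne L)
  have hn : ((n : ℕ) : ZMod (n + 1)) + 1 = 0 := by exact_mod_cast ZMod.natCast_self (n + 1)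
  have hsum : ∑ l : ZMod (n + 1), (i l : ℕ) * (i (l + 1) : ℕ) =
      ∑ l ∈ Finset.range n, (i (l : ZMod (n + 1)) : ℕ) * (i ((l + 1 : ℕ) : ZMod (n + 1)) : ℕ)
        + (i (n : ZMod (n + 1)) : ℕ) * (i 0 : ℕ) := by
    rw [ZMod.sum_univ_eq_sum_range, Finset.sum_range_succ, hn]
    simp only [Nat.cast_add, Nat.cast_one]
  simp only [Nat.succ_eq_add_one, Matrix.trace, Matrix.diag_apply]
  rw [hsum, ZMod.prod_univ_eq_prod_range]
  simp only [prod_ofFn_czxB_apply (fun l => i (l : ZMod (n + 1))) (fun l => j (l : ZMod (n + 1)))]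
  rw [Finset.sum_eq_single (i 0) (fun c _ hc => by simp [hc]) (by simp)]
  simp
end

section
/- Let B : Fin 2 → Fin 2 → Matrix (Fin 2) (Fin 2) ℂ be given by B^(01) = !![1, 1; 0, 0], B^(10) = !![0, 0; 1, −1], B^(00) = B^(11) = 0. Then: (i) for every L ≥ 1 the matrix U_L, indexed by pairs of tuples in (Fin L → Fin 2) and with entries (U_L)_{i,j} = trace(B^(i₁j₁)·B^(i₂j₂)⋯B^(i_Lj_L)), is unitary, i.e. U_L · U_Lᴴ = 1; (ii) B is injective after blocking two sites, i.e. the linear map from Matrix (Fin 2) (Fin 2) ℂ to families of complex numbers indexed by (i₁, j₁, i₂, j₂) ∈ (Fin 2)⁴, sending M to (trace(M·B^(i₁j₁)·B^(i₂j₂)))_{(i₁,j₁,i₂,j₂)}, is injective. -/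
open Matrix

/-- The sign `(-1) ^ (b * c)`. -/
def czSign (b c : Fin 2) : ℂ := if b = 1 ∧ c = 1 then -1 else 1

lemma czSign_eq_one_or (b c : Fin 2) : czSign b c = 1 ∨ czSign b c = -1 := by
  unfold czSign
  split_ifs <;> simp

lemma czxB_add_one (a : Fin 2) :
    czxB a (a + 1) = vecMulVec (Pi.single a 1) (czSign a) := by
  ext r c
  fin_cases a <;> fin_cases r <;> fin_cases c <;> simp [czxB, czSign, vecMulVec_apply]

lemma czxB_eq_zero {a b : Fin 2} (h : b ≠ a + 1) : czxB a b = 0 := by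
  fin_cases a <;> fin_cases b <;> simp_all [czxB]

/-- A nonempty product of the nonzero tensor entries is, up to a sign, the rank-one matrix
determined by the first and the last index. -/
lemma exists_prod_czxB (n : ℕ) (i : Fin (n + 1) → Fin 2) :
    ∃ (b : Fin 2) (s : ℂ), (s = 1 ∨ s = -1) ∧
      (List.ofFn fun l => czxB (i l) (i l + 1)).prod =
        s • vecMulVec (Pi.single (i 0) 1) (czSign b) := by
  induction n with
  | zero => exact ⟨i 0, 1, Or.inl rfl, by simp [czxB_add_one]⟩
  | succ n ih =>
    obtain ⟨b, s, hs, h⟩ := ih fun l => i l.succ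
    refine ⟨b, s * czSign (i 0) (i (Fin.succ 0)), ?_, ?_⟩
    · rcases hs with rfl | rfl <;>
        rcases czSign_eq_one_or (i 0) (i (Fin.succ 0)) with h' | h' <;> rw [h'] <;> simp
    · rw [List.ofFn_succ, List.prod_cons, h, czxB_add_one, Matrix.mul_smul,
        vecMulVec_mul_vecMulVec, dotProduct_single_one, vecMulVec_smul, smul_smul]

lemma trace_prod_czxB (n : ℕ) (i : Fin (n + 1) → Fin 2) :
    (List.ofFn fun l => czxB (i l) (i l + 1)).prod.trace = 1 ∨
      (List.ofFn fun l => czxB (i l) (i l + 1)).prod.trace = -1 := by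
  obtain ⟨b, s, hs, h⟩ := exists_prod_czxB n i
  rw [h, trace_smul, trace_vecMulVec, single_one_dotProduct]
  rcases hs with rfl | rfl <;>
    rcases czSign_eq_one_or b (i 0) with h' | h' <;> simp [h']

lemma prod_czxB_eq_zero {L : ℕ} {i j : Fin L → Fin 2} (h : j ≠ fun l => i l + 1) :
    (List.ofFn fun l => czxB (i l) (j l)).prod = 0 := by
  obtain ⟨l, hl⟩ := Function.ne_iff.mp h
  exact List.prod_eq_zero (List.mem_ofFn.mpr ⟨l, czxB_eq_zero hl⟩)

/-- The CZX transition tensor `B_Z` is a normal MPU tensor: (i) the MPO it generates is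
unitary at every length `L ≥ 1`, and (ii) it is injective after blocking two sites. -/
theorem stmt_12 :
    (∀ L : ℕ, 1 ≤ L →
      (Matrix.of fun i j : Fin L → Fin 2 =>
          ((List.ofFn fun l : Fin L => czxB (i l) (j l)).prod).trace)
        * (Matrix.of fun i j : Fin L → Fin 2 =>
          ((List.ofFn fun l : Fin L => czxB (i l) (j l)).prod).trace)ᴴ = 1) ∧
    Function.Injective (fun M : Matrix (Fin 2) (Fin 2) ℂ =>
      fun q : Fin 2 × Fin 2 × Fin 2 × Fin 2 =>
        (M * czxB q.1 q.2.1 * czxB q.2.2.1 q.2.2.2).trace) := by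
  constructor
  · rintro (_ | n) hL
    · simp at hL
    ext i k
    rw [mul_apply, Finset.sum_eq_single fun l => i l + 1]
    · simp only [conjTranspose_apply, of_apply]
      by_cases hik : i = k
      · subst hik
        rcases trace_prod_czxB n i with h | h <;> rw [h] <;> simp
      · rw [prod_czxB_eq_zero (i := k), one_apply_ne hik]
        · simp
        · exact fun h => hik (funext fun l => add_right_cancel (congrFun h l))
    · intro j _ hj
      rw [of_apply, prod_czxB_eq_zero hj, trace_zero, zero_mul]
    · simp
  · intro M N h
    have key (a c : Fin 2) := congrFun h (a, a + 1, c, c + 1)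
    have h00 := key 0 0
    have h01 := key 0 1
    have h10 := key 1 0
    have h11 := key 1 1
    simp [czxB, trace_fin_two, mul_apply, Fin.sum_univ_two] at h00 h01 h10 h11
    ext r c
    fin_cases r <;> fin_cases c <;> simp <;> grind
end

section
/- Let B : Fin 2 → Fin 2 → Matrix (Fin 2) (Fin 2) ℂ be given by B^(01) = !![1, 1; 0, 0], B^(10) = !![0, 0; 1, −1], B^(00) = B^(11) = 0, and define the composed tensor B_ZZ^(ij) := ∑_{k ∈ Fin 2} B^(ik) ⊗ₖ B^(kj), a 4×4 matrix with rows and columns indexed by Fin 2 × Fin 2 (⊗ₖ is the Kronecker product). Let W be the column vector with W_{(a,b)} equal to (√2)⁻¹·(0, 1, −1, 0) in the order (0,0), (0,1), (1,0), (1,1), and let V be the row vector with the same entries (√2)⁻¹·(0, 1, −1, 0). Then: (a) B_ZZ^(01) = 0 and B_ZZ^(10) = 0; (b) V·W = 1; (c) for every m ≥ 1 and all words i, j : Fin m → Fin 2, V·B_ZZ^(i₁j₁)·B_ZZ^(i₂j₂)⋯B_ZZ^(iₘjₘ)·W = ((−1)^m · ∏_l (if i_l = j_l then 1 else 0)) •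 1, i.e. (V, W) is a reduction from B_ZZ to the trivial tensor with constant c = −1; (d) consequently trace(B_ZZ^(i₁j₁)⋯B_ZZ^(i_Lj_L)) = (−1)^L · ∏_l (if i_l = j_l then 1 else 0) for every L ≥ 1; (e) the matrix T := (−1/2) • (B_ZZ^(00) + B_ZZ^(11)) satisfies T·W = W and V·T = V. -/
open Matrix Kronecker

/-- The composed tensor `B_ZZ^(ij) = ∑_k B_Z^(ik) ⊗ₖ B_Z^(kj)`. -/
noncomputable def czxBzz (i j : Fin 2) : Matrix (Fin 2 × Fin 2) (Fin 2 × Fin 2) ℂ :=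
  ∑ k : Fin 2, czxB i k ⊗ₖ czxB k j

/-- The right reduction (column) vector `W = (√2)⁻¹·(0,1,−1,0)ᵀ`. -/
noncomputable def czxW : Matrix (Fin 2 × Fin 2) (Fin 1) ℂ :=
  Matrix.of fun p _ =>
    (Real.sqrt 2 : ℂ)⁻¹ * (if p = (0, 1) then 1 else if p = (1, 0) then -1 else 0)

/-- The left reduction (row) vector `V = (√2)⁻¹·(0,1,−1,0)`. -/
noncomputable def czxV : Matrix (Fin 1) (Fin 2 × Fin 2) ℂ :=
  Matrix.of fun _ p =>
    (Real.sqrt 2 : ℂ)⁻¹ * (if p = (0, 1) then 1 else if p = (1, 0) then -1 else 0)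

/-- A word in rank-one matrices whose mutual overlaps are all `c` is again rank one. -/
theorem prod_ofFn_smul_vecMulVec {R p : Type*} [CommRing R] [Fintype p] [DecidableEq p] (c : R)
    (n : ℕ) (d : Fin (n + 1) → R) (u w : Fin (n + 1) → p → R) (h : ∀ k l, w k ⬝ᵥ u l = c) :
    (List.ofFn fun l => d l • vecMulVec (u l) (w l)).prod
      = (c ^ n * ∏ l, d l) • vecMulVec (u 0) (w (Fin.last n)) := by
  induction n with
  | zero => simp
  | succ n ih =>
    rw [List.ofFn_succ, List.prod_cons,
      ih (fun l => d l.succ) (fun l => u l.succ) (fun l => w l.succ) fun k l => h _ _,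
      smul_mul_smul_comm, vecMulVec_mul_vecMulVec, h, Fin.prod_univ_succ d, Fin.succ_last,
      vecMulVec_smul, smul_smul]
    congr 1
    ring

/-- The column factor of the rank-one matrix `B_ZZ^(ii)`. -/
def czxCol (i : Fin 2) : Fin 2 × Fin 2 → ℂ := fun p =>
  if p = (i, 1 - i) then (-1) ^ (i : ℕ) else 0

/-- The row factor of the rank-one matrix `B_ZZ^(ii)`. -/
def czxRow (i : Fin 2) : Fin 2 × Fin 2 → ℂ := fun p =>
  if i = 0 then (-1) ^ (p.2 : ℕ) else -(-1) ^ (p.1 : ℕ)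

theorem czxBzz_eq_smul_vecMulVec (i j : Fin 2) :
    czxBzz i j = (if i = j then (1 : ℂ) else 0) • vecMulVec (czxCol i) (czxRow i) := by
  ext ⟨a, b⟩ ⟨a', b'⟩
  fin_cases i <;> fin_cases j <;> fin_cases a <;> fin_cases b <;> fin_cases a' <;>
    fin_cases b' <;> simp [czxBzz, czxB, czxCol, czxRow, vecMulVec_apply]

theorem czxRow_dotProduct_czxCol (i j : Fin 2) : czxRow i ⬝ᵥ czxCol j = -1 := by
  fin_cases i <;> fin_cases j <;> simp [czxRow, czxCol, dotProduct]

theorem czxBzz_prod_ofFn (n : ℕ) (i j : Fin (n + 1) → Fin 2) :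
    (List.ofFn fun l => czxBzz (i l) (j l)).prod
      = ((-1 : ℂ) ^ n * ∏ l, (if i l = j l then (1 : ℂ) else 0)) •
          vecMulVec (czxCol (i 0)) (czxRow (i (Fin.last n))) := by
  simp_rw [czxBzz_eq_smul_vecMulVec]
  exact prod_ofFn_smul_vecMulVec (-1) n _ (fun l => czxCol (i l)) (fun l => czxRow (i l))
    fun k l => czxRow_dotProduct_czxCol _ _

theorem inv_sqrt_two_mul_self : (Real.sqrt 2 : ℂ)⁻¹ * (Real.sqrt 2 : ℂ)⁻¹ = 1 / 2 := by
  rw [← mul_inv, ← Complex.ofReal_mul, Real.mul_self_sqrt (by norm_num)]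
  norm_num

theorem czxV_mul_czxW : czxV * czxW = 1 := by
  ext a b
  fin_cases a; fin_cases b
  simp [czxV, czxW, mul_apply, Fintype.sum_prod_type, inv_sqrt_two_mul_self]
  norm_num

theorem czxV_mulVec_czxCol (i : Fin 2) : czxV *ᵥ czxCol i = fun _ => (Real.sqrt 2 : ℂ)⁻¹ := by
  ext a
  fin_cases i <;> simp [czxV, czxCol, mulVec, dotProduct]

theorem czxRow_vecMul_czxW (i : Fin 2) :
    czxRow i ᵥ* czxW = fun _ => -2 * (Real.sqrt 2 : ℂ)⁻¹ := by
  ext a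
  fin_cases i <;> simp [czxW, czxRow, vecMul, dotProduct, Fintype.sum_prod_type] <;> ring

theorem czxV_mul_vecMulVec_mul_czxW (i j : Fin 2) :
    czxV * vecMulVec (czxCol i) (czxRow j) * czxW = -1 := by
  rw [mul_vecMulVec, vecMulVec_mul, czxV_mulVec_czxCol, czxRow_vecMul_czxW]
  ext a b
  fin_cases a; fin_cases b
  simp only [vecMulVec_apply]
  rw [mul_left_comm, inv_sqrt_two_mul_self]
  simp

/-- For the CZX model: (a) `B_ZZ^(01) = B_ZZ^(10) = 0`; (b) `V·W = 1`; (c) `(V, W)` is a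
reduction from `B_ZZ` to the trivial tensor with constant `c = −1`; (d) the MPO generated
by `B_ZZ` equals `(−1)^L` times the identity MPO; (e) the `(2,1)`-transfer matrix
`T = (−1/2)•(B_ZZ^(00) + B_ZZ^(11))` satisfies `T·W = W` and `V·T = V`. -/
theorem stmt_13 :
    (czxBzz 0 1 = 0 ∧ czxBzz 1 0 = 0) ∧
    (czxV * czxW = 1) ∧
    (∀ m : ℕ, 1 ≤ m → ∀ i j : Fin m → Fin 2,
      czxV * (List.ofFn fun l : Fin m => czxBzz (i l) (j l)).prod * czxW
        = ((-1 : ℂ) ^ m * ∏ l : Fin m, (if i l = j l then (1 : ℂ) else 0))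
            • (1 : Matrix (Fin 1) (Fin 1) ℂ)) ∧
    (∀ L : ℕ, 1 ≤ L → ∀ i j : Fin L → Fin 2,
      ((List.ofFn fun l : Fin L => czxBzz (i l) (j l)).prod).trace
        = (-1 : ℂ) ^ L * ∏ l : Fin L, (if i l = j l then (1 : ℂ) else 0)) ∧
    (((-1 / 2 : ℂ) • (czxBzz 0 0 + czxBzz 1 1)) * czxW = czxW ∧
      czxV * ((-1 / 2 : ℂ) • (czxBzz 0 0 + czxBzz 1 1)) = czxV) := by
  refine ⟨⟨?_, ?_⟩, czxV_mul_czxW, ?_, ?_, ?_, ?_⟩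
  · simp [czxBzz_eq_smul_vecMulVec]
  · simp [czxBzz_eq_smul_vecMulVec]
  · rintro (_ | n) hm i j
    · omega
    rw [czxBzz_prod_ofFn, Matrix.mul_smul, Matrix.smul_mul, czxV_mul_vecMulVec_mul_czxW, pow_succ,
      smul_neg, ← neg_smul]
    congr 1
    ring
  · rintro (_ | n) hL i j
    · omega
    rw [czxBzz_prod_ofFn, trace_smul, trace_vecMulVec, dotProduct_comm, czxRow_dotProduct_czxCol,
      smul_eq_mul, pow_succ]
    ring
  · simp only [czxBzz_eq_smul_vecMulVec, if_true, one_smul, Matrix.smul_mul, Matrix.add_mul,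
      vecMulVec_mul, czxRow_vecMul_czxW]
    ext ⟨a, b⟩ c
    fin_cases a <;> fin_cases b <;> simp [czxW, czxCol, vecMulVec_apply] <;> ring
  · simp only [czxBzz_eq_smul_vecMulVec, if_true, one_smul, Matrix.mul_smul, Matrix.mul_add,
      mul_vecMulVec, czxV_mulVec_czxCol]
    ext c ⟨a, b⟩
    fin_cases a <;> fin_cases b <;> simp [czxV, czxRow, vecMulVec_apply] <;> ring
end

section
/- Define ω : ZMod 2 → ZMod 2 → ZMod 2 → ℂˣ by ω(g, h, k) = −1 if g = h = k = 1, and ω(g, h, k) = 1 otherwise. Then: (i) ω satisfies the 3-cocycle identity ω(h, k, l) · ω(g + h, k, l)⁻¹ · ω(g, h + k, l) · ω(g, h, k + l)⁻¹ · ω(g, h, k) = 1 for all g, h, k, l ∈ ZMod 2; and (ii) ω is not a coboundary: there is no function β : ZMod 2 → ZMod 2 → ℂˣ such that ω(g, h, k) = β(h, k) · β(g + h, k)⁻¹ · β(g, h + k) · β(g, h)⁻¹ for all g, h, k ∈ ZMod 2. Hence ω represents a nontrivial class in the group cohomology H³(ℤ/2ℤ, ℂˣ) with trivial action. -/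
/-- The 3-cochain on `ℤ/2ℤ` (with values in `ℂˣ`, trivial action) extracted from the
quadruple inner products of the CZX model: `ω(g,h,k) = −1` iff `g = h = k = 1`. -/
noncomputable def czxOmega (g h k : ZMod 2) : ℂˣ :=
  if g = 1 ∧ h = 1 ∧ k = 1 then -1 else 1

/-- `ω` is a 3-cocycle on `ℤ/2ℤ` with values in `ℂˣ` but not a 3-coboundary; hence it
represents a nontrivial class in `H³(ℤ/2ℤ, ℂˣ)`. -/
theorem stmt_15 :
    (∀ g h k l : ZMod 2,
      czxOmega h k l * (czxOmega (g + h) k l)⁻¹ * czxOmega g (h + k) l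
        * (czxOmega g h (k + l))⁻¹ * czxOmega g h k = 1) ∧
    ¬ ∃ β : ZMod 2 → ZMod 2 → ℂˣ,
      ∀ g h k : ZMod 2,
        czxOmega g h k = β h k * (β (g + h) k)⁻¹ * β g (h + k) * (β g h)⁻¹ := by
  have hneg : (-1 : ℂˣ) ≠ 1 := fun h => by
    have := congrArg Units.val h
    norm_num at this
  have two : (1 + 1 : ZMod 2) = 0 := rfl
  refine ⟨fun g h k l => ?_, ?_⟩
  · have cases : ∀ x : ZMod 2, x = 0 ∨ x = 1 := by decide
    rcases cases g with rfl | rfl <;> rcases cases h with rfl | rfl <;>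
      rcases cases k with rfl | rfl <;> rcases cases l with rfl | rfl <;> simp [czxOmega, two]
  · rintro ⟨β, hβ⟩
    have h001 : β 0 1 = β 0 0 :=
      mul_inv_eq_one.1 (by simpa [czxOmega] using (hβ 0 0 1).symm)
    have h100 : β 1 0 = β 0 0 :=
      (mul_inv_eq_one.1 (by simpa [czxOmega] using (hβ 1 0 0).symm)).symm
    have h111 := hβ 1 1 1
    simp only [czxOmega, two, and_self, if_true, h001, h100,
      inv_mul_cancel_right, mul_inv_cancel] at h111
    exact hneg h111
end
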